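/- Let (𝔊,Φ) be a structurally compatible right-permutative cellular automaton of radius 1 on a topological Markov chain 𝔊 such that the cellular automaton Φ̃ on the full shift G^ℤ with the same local rule is N-scaling for some N ≥ 2. Suppose there is a 1-block topological conjugacy, induced by a bijection of letters, between (𝔊,Φ) and (𝔎 × 𝔅, Φ_𝔎 × g_𝔅), where 𝔎 and 𝔅 are topological Markov chains, Φ_𝔎 is an affine c.a. on 𝔎, g_𝔅 is a translation on 𝔅, and the SC bipermutative c.a. (𝔎, Φ_𝔎) is regular and simple. Then for every shift-invariant probability measure μ on 𝔊 with complete connections (compatible with 𝔊) and summable decay, the Cesàro mean distribution (1/N) ∑_{n=0}^{N−1} μ ∘ Φ^{−n} converges in the weak-* topology. -/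

import Mathlib

open Filter Topology MeasureTheory
open scoped ENNReal

namespace CAStmt

/-- The shift map on bi-infinite sequences. -/
def shiftMap {G : Type*} (x : ℤ → G) : ℤ → G := fun n => x (n + 1)

/-- The topological Markov chain determined by the transition set `E`. -/
def TMC {G : Type*} (E : Set (G × G)) : Set (ℤ → G) := {x | ∀ i : ℤ, (x i, x (i + 1)) ∈ E}

/-- The word `w` occurs in some point of `X`. -/
def WordIn {G : Type*} (X : Set (ℤ → G)) {m : ℕ} (w : Fin m → G) : Prop :=
  ∃ x ∈ X, ∃ j : ℤ, ∀ i : Fin m, x (j + ((i : ℕ) : ℤ)) = w i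

/-- Every letter of the alphabet occurs in some point of the TMC. -/
def EveryLetterOccurs {G : Type*} (E : Set (G × G)) : Prop :=
  ∀ g : G, ∃ x ∈ TMC E, ∃ i : ℤ, x i = g

/-- The radius-1 cellular automaton map with local rule `φ`. -/
def CA {G : Type*} (φ : G → G → G) (x : ℤ → G) : ℤ → G := fun j => φ (x j) (x (j + 1))

/-- Structural compatibility of the local rule `φ` with the TMC of `E`. -/
def SC {G : Type*} (E : Set (G × G)) (φ : G → G → G) : Prop :=
  ∀ x ∈ TMC E, ∀ y ∈ TMC E, (fun i => φ (x i) (y i)) ∈ TMC E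

def RightPerm {G : Type*} (φ : G → G → G) : Prop := ∀ a, Function.Bijective (φ a)

def LeftPerm {G : Type*} (φ : G → G → G) : Prop := ∀ b, Function.Bijective (fun a => φ a b)

/-- Irreducibility: any two letters are joined by an allowed word `(u,v₁,…,v_k,w)`, `k ≥ 1`. -/
def IrreducibleTMC {G : Type*} (E : Set (G × G)) : Prop :=
  ∀ u w : G, ∃ x ∈ TMC E, ∃ i j : ℤ, i + 1 < j ∧ x i = u ∧ x j = w

/-- Mixing with mixing constant `q`. -/
def MixingTMCWith {G : Type*} (E : Set (G × G)) (q : ℕ) : Prop :=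
  1 ≤ q ∧ ∀ k : ℕ, q ≤ k → ∀ u w : G,
    ∃ x ∈ TMC E, ∃ i : ℤ, x i = u ∧ x (i + (k : ℤ) + 1) = w

def MixingTMC {G : Type*} (E : Set (G × G)) : Prop := ∃ q, MixingTMCWith E q

/-- `Φ` is `N`-scaling on `X`: `(Φ^N x)₀ = φ(x₀, x_N)`. -/
def NScalingOn {G : Type*} (X : Set (ℤ → G)) (φ : G → G → G) (N : ℕ) : Prop :=
  ∀ x ∈ X, (CA φ)^[N] x 0 = φ (x 0) (x (N : ℤ))

/-- The TMC `𝔥(𝔽,τ,n)` over the alphabet `F × Fin n`. -/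
def hTMC {F : Type*} (τ : Equiv.Perm F) (n : ℕ) : Set (ℤ → F × Fin n) :=
  TMC {p : (F × Fin n) × (F × Fin n) | p.2.1 = τ p.1.1}

/-- `op` is a `k`-block operation (memory 0, anticipation `k-1`) closed on `Λ`. -/
def KBlockOp {A : Type*} (Λ : Set (ℤ → A)) (k : ℕ)
    (op : (ℤ → A) → (ℤ → A) → (ℤ → A)) : Prop :=
  (∀ x ∈ Λ, ∀ y ∈ Λ, op x y ∈ Λ) ∧
  ∃ ρ : (Fin k → A) → (Fin k → A) → A,
    ∀ x ∈ Λ, ∀ y ∈ Λ, ∀ j : ℤ,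
      op x y j = ρ (fun i => x (j + ((i : ℕ) : ℤ))) (fun i => y (j + ((i : ℕ) : ℤ)))

/-- `op` is a quasigroup operation on `Λ`: all translations are bijections of `Λ`. -/
def QuasigroupOp {A : Type*} (Λ : Set (ℤ → A)) (op : (ℤ → A) → (ℤ → A) → (ℤ → A)) : Prop :=
  ∀ z ∈ Λ, Set.BijOn (fun x => op x z) Λ Λ ∧ Set.BijOn (fun y => op z y) Λ Λ

/-- A 1-block topological conjugacy between `(X,Φ)` and `(Y,Ψ)` induced by the letter map `θ`. -/
def OneBlockConjugacy {A B : Type*} (X : Set (ℤ → A)) (Φ : (ℤ → A) → (ℤ → A))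
    (Y : Set (ℤ → B)) (Ψ : (ℤ → B) → (ℤ → B)) (θ : A → B) : Prop :=
  Set.BijOn (fun x => θ ∘ x) X Y ∧ ∀ x ∈ X, θ ∘ (Φ x) = Ψ (θ ∘ x)

/-- `add` is an abelian group operation. -/
def IsAbelianGroupOp {K : Type*} (add : K → K → K) : Prop :=
  (∀ a b c, add (add a b) c = add a (add b c)) ∧ (∀ a b, add a b = add b a) ∧
  ∃ z : K, (∀ a, add z a = a) ∧ ∀ a, ∃ b, add a b = z

/-- The product transition set on `K × B`. -/
def prodE {K B : Type*} (EK : Set (K × K)) (EB : Set (B × B)) : Set ((K × B) × (K × B)) :=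
  {p | (p.1.1, p.2.1) ∈ EK ∧ (p.1.2, p.2.2) ∈ EB}

/-- `φK` is an affine local rule for the abelian group operation `add`. -/
def IsAffineRuleExpl {K : Type*} (add : K → K → K) (φK : K → K → K) : Prop :=
  IsAbelianGroupOp add ∧
  ∃ (η ρc : K → K) (c : K), Function.Bijective η ∧ Function.Bijective ρc ∧
    (∀ a b, η (add a b) = add (η a) (η b)) ∧ (∀ a b, ρc (add a b) = add (ρc a) (ρc b)) ∧
    (∀ a, η (ρc a) = ρc (η a)) ∧
    ∀ a b, φK a b = add (add (η a) (ρc b)) c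

/-- The cylinder on the word `w` at coordinates `0,…,m-1`. -/
def cyl {A : Type*} {m : ℕ} (w : Fin m → A) : Set (ℤ → A) :=
  {x | ∀ i : Fin m, x ((i : ℕ) : ℤ) = w i}

/-- A past: `p i` is the letter at coordinate `-(i+1)`; all transitions allowed. -/
def IsPast {A : Type*} (E : Set (A × A)) (p : ℕ → A) : Prop :=
  ∀ i : ℕ, (p (i + 1), p i) ∈ E

/-- The word `(w_{-m},…,w_{-1})` of the past `p`. -/
def pastWord {A : Type*} (p : ℕ → A) (m : ℕ) : Fin m → A :=
  fun j => p (m - 1 - (j : ℕ))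

/-- `μ` has complete connections (compatible with the TMC of `E`) and summable decay. -/
def CCSD {A : Type*} [MeasurableSpace A] (E : Set (A × A)) (μ : Measure (ℤ → A)) : Prop :=
  ∃ ν : (ℕ → A) → A → ℝ,
    (∀ p, IsPast E p → ∀ a, (p 0, a) ∈ E →
      0 < ν p a ∧
      Tendsto (fun m : ℕ =>
          (μ (cyl (Fin.snoc (pastWord p m) a))).toReal / (μ (cyl (pastWord p m))).toReal)
        atTop (nhds (ν p a))) ∧
    ∃ γ : ℕ → ℝ, Summable γ ∧
      ∀ m : ℕ, 1 ≤ m → ∀ p q, IsPast E p → IsPast E q → (∀ i < m, p i = q i) →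
        ∀ a, (p 0, a) ∈ E → |ν p a / ν q a - 1| ≤ γ m

/-- A shift-invariant probability measure carried by the TMC of `E`, positive on allowed
cylinders. -/
def GoodMeasure {A : Type*} [MeasurableSpace A] (E : Set (A × A)) (μ : Measure (ℤ → A)) : Prop :=
  IsProbabilityMeasure μ ∧ Measure.map shiftMap μ = μ ∧ μ (TMC E) = 1 ∧
  ∀ (m : ℕ) (w : Fin m → A), WordIn (TMC E) w → 0 < μ (cyl w)

/-- The identification of `𝔽 × Σ_n` with `𝔥(𝔽,τ,n)`. -/
def ident {F : Type*} (τ : Equiv.Perm F) {n : ℕ} (f : F) (y : ℤ → Fin n) : ℤ → F × Fin n :=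
  fun i => ((τ ^ i) f, y i)

/-- A quasigroup operation on an alphabet. -/
def QuasigroupPointOp {K : Type*} (o : K → K → K) : Prop :=
  ∀ a, Function.Bijective (fun x => o x a) ∧ Function.Bijective (o a)

/-- The data witnessing that an SC bipermutative c.a. is regular and simple. -/
def RegularSimpleData {K F : Type*} (EK : Set (K × K)) (φK : K → K → K)
    (τ : Equiv.Perm F) (n k : ℕ)
    (op : (ℤ → F × Fin n) → (ℤ → F × Fin n) → (ℤ → F × Fin n))
    (θ : K → F × Fin n) (oF : F → F → F) (oS : Fin n → Fin n → Fin n) : Prop :=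
  1 ≤ n ∧ 1 ≤ k ∧
  KBlockOp (hTMC τ n) k op ∧ QuasigroupOp (hTMC τ n) op ∧
  OneBlockConjugacy (TMC EK) (CA φK) (hTMC τ n) (fun x => op x (shiftMap x)) θ ∧
  QuasigroupPointOp oF ∧ QuasigroupPointOp oS ∧
  ∀ (f g : F) (y z : ℤ → Fin n),
    op (ident τ f y) (ident τ g z) = ident τ (oF f g) (fun i => oS (y i) (z i))

/-- An SC bipermutative c.a. is regular and simple. -/
def RegularSimple {K : Type*} (EK : Set (K × K)) (φK : K → K → K) : Prop :=
  ∃ (F : Type) (_ : Fintype F) (τ : Equiv.Perm F) (n k : ℕ)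
    (op : (ℤ → F × Fin n) → (ℤ → F × Fin n) → (ℤ → F × Fin n))
    (θ : K → F × Fin n) (oF : F → F → F) (oS : Fin n → Fin n → Fin n),
    RegularSimpleData EK φK τ n k op θ oF oS

/-- Weak-* convergence of the Cesàro means of `μ` under `Φ` to `κ`. -/
def CesaroTendstoTo {G : Type*} [TopologicalSpace G] [MeasurableSpace G]
    (μ : Measure (ℤ → G)) (Φ : (ℤ → G) → (ℤ → G)) (κ : Measure (ℤ → G)) : Prop :=
  ∀ f : C(ℤ → G, ℝ), Tendsto
    (fun N : ℕ => (N : ℝ)⁻¹ * ∑ n ∈ Finset.range N, ∫ x, f (Φ^[n] x) ∂μ)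
    atTop (nhds (∫ x, f x ∂κ))

/-- `κ` is the Parry measure of the irreducible TMC of `E`. -/
def IsParryMeasure {G : Type*} [Fintype G] [MeasurableSpace G] (E : Set (G × G))
    (κ : Measure (ℤ → G)) : Prop :=
  IsProbabilityMeasure κ ∧ Measure.map shiftMap κ = κ ∧
  ∃ (lam : ℝ) (r l : G → ℝ), 0 < lam ∧ (∀ a, 0 < r a) ∧ (∀ a, 0 < l a) ∧
    (∀ a : G, (∑ b : G, E.indicator (fun _ => r b) (a, b)) = lam * r a) ∧
    (∀ b : G, (∑ a : G, E.indicator (fun _ => l a) (a, b)) = lam * l b) ∧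
    (∑ a : G, l a * r a) = 1 ∧
    ∀ (m : ℕ) (w : Fin (m + 1) → G), WordIn (TMC E) w →
      (κ (cyl w)).toReal = l (w 0) * r (w (Fin.last m)) / lam ^ m

/-- Entropy of the refinement `P ∨ T⁻¹P ∨ ⋯ ∨ T^{-(n-1)}P`. -/
noncomputable def joinEntropy {X : Type*} [MeasurableSpace X] (μ : Measure X) (T : X → X)
    {r : ℕ} (P : Fin r → Set X) (n : ℕ) : ℝ :=
  -∑ c : Fin n → Fin r,
      ((μ (⋂ i : Fin n, T^[(i : ℕ)] ⁻¹' P (c i))).toReal *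
        Real.log (μ (⋂ i : Fin n, T^[(i : ℕ)] ⁻¹' P (c i))).toReal)

/-- The Kolmogorov–Sinai entropy `h_μ(T)` is positive: some finite measurable partition has
positive entropy. -/
def KSEntropyPos {X : Type*} [MeasurableSpace X] (μ : Measure X) (T : X → X) : Prop :=
  ∃ (r : ℕ) (P : Fin r → Set X), (∀ i, MeasurableSet (P i)) ∧
    Pairwise (Function.onFun Disjoint P) ∧ (⋃ i, P i) = Set.univ ∧
    0 < Filter.liminf (fun n : ℕ => joinEntropy μ T P n / n) Filter.atTop

end CAStmt

namespace CAStmt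

/-- The number of entries in row `q` of Pascal's triangle which are not divisible by `p`. -/
def binomCount (p q : ℕ) : ℕ := ((Finset.range (q + 1)).filter fun t => ¬ p ∣ q.choose t).card

lemma binomCount_pos {p : ℕ} (hp : p.Prime) (q : ℕ) : 0 < binomCount p q := by
  refine Finset.card_pos.2 ⟨0, ?_⟩
  simp [hp.ne_one]

lemma not_dvd_choose_mul_add {p : ℕ} (hp : p.Prime) {b c t d : ℕ} (hc : c < p) (hd : d < p)
    (h1 : ¬ p ∣ b.choose t) (h2 : c.choose d = 1) :
    ¬ p ∣ (p * b + c).choose (p * t + d) := by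
  have := Fact.mk hp
  have h := Choose.choose_modEq_choose_mod_mul_choose_div_nat (p := p) (n := p * b + c)
    (k := p * t + d)
  rw [Nat.mul_add_mod, Nat.mul_add_mod, Nat.mod_eq_of_lt hc, Nat.mod_eq_of_lt hd,
    Nat.mul_add_div hp.pos, Nat.mul_add_div hp.pos, Nat.div_eq_of_lt hc, Nat.div_eq_of_lt hd,
    h2] at h
  rwa [h.dvd_iff dvd_rfl, one_mul, add_zero, add_zero]

lemma binomCount_le_mul_add {p : ℕ} (hp : p.Prime) (b : ℕ) {c : ℕ} (hc : c < p) :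
    binomCount p b ≤ binomCount p (p * b + c) := by
  refine Finset.card_le_card_of_injOn (fun t => p * t + 0) ?_ ?_
  · intro t ht
    simp only [Finset.coe_filter, Finset.mem_range, Set.mem_ofPred_eq] at ht ⊢
    refine ⟨?_, not_dvd_choose_mul_add hp hc hp.pos ht.2 (Nat.choose_zero_right c)⟩
    nlinarith [hp.pos, Nat.mul_le_mul_left p (Nat.lt_succ_iff.1 ht.1)]
  · intro t _ t' _ h
    simpa [hp.ne_zero] using h

lemma two_mul_binomCount_le {p : ℕ} (hp : p.Prime) (b : ℕ) {c : ℕ} (hc : c < p) (hc0 : 0 < c) :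
    2 * binomCount p b ≤ binomCount p (p * b + c) := by
  classical
  set T := (Finset.range (b + 1)).filter fun t => ¬ p ∣ b.choose t with hT
  have hinj : ∀ d : ℕ, Function.Injective fun t => p * t + d := by
    intro d t t' h
    simpa [hp.ne_zero] using h
  have hdisj : Disjoint (T.image fun t => p * t + 0) (T.image fun t => p * t + c) := by
    rw [Finset.disjoint_left]
    intro x hx hx'
    obtain ⟨t, -, rfl⟩ := Finset.mem_image.1 hx
    obtain ⟨t', -, h⟩ := Finset.mem_image.1 hx'
    have := congrArg (· % p) h
    simp only [Nat.mul_add_mod, Nat.mod_eq_of_lt hc, Nat.zero_mod] at this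
    omega
  have hcard : (T.image (fun t => p * t + 0) ∪ T.image fun t => p * t + c).card
      = 2 * binomCount p b := by
    rw [Finset.card_union_of_disjoint hdisj, Finset.card_image_of_injective _ (hinj 0),
      Finset.card_image_of_injective _ (hinj c), binomCount, two_mul]
  rw [← hcard]
  refine Finset.card_le_card ?_
  have key : ∀ d ≤ c, c.choose d = 1 → ∀ t ∈ T, p * t + d ∈
      (Finset.range (p * b + c + 1)).filter fun t => ¬ p ∣ (p * b + c).choose t := by
    intro d hd h1 t ht
    simp only [hT, Finset.mem_filter, Finset.mem_range] at ht ⊢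
    refine ⟨?_, not_dvd_choose_mul_add hp hc (hd.trans_lt hc) ht.2 h1⟩
    nlinarith [Nat.mul_le_mul_left p (Nat.lt_succ_iff.1 ht.1)]
  intro x hx
  rcases Finset.mem_union.1 hx with hx | hx <;> obtain ⟨t, ht, rfl⟩ := Finset.mem_image.1 hx
  · exact key 0 (Nat.zero_le _) (Nat.choose_zero_right c) t ht
  · exact key c le_rfl (Nat.choose_self c) t ht

lemma sum_range_mul_eq {M : Type*} [AddCommMonoid M] (f : ℕ → M) (p n : ℕ) :
    ∑ j ∈ Finset.range (p * n), f j
      = ∑ b ∈ Finset.range n, ∑ c ∈ Finset.range p, f (p * b + c) := by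
  induction n with
  | zero => simp
  | succ n ih => rw [Nat.mul_succ, Finset.sum_range_add, ih, Finset.sum_range_succ]

lemma sum_inv_binomCount_le {p : ℕ} (hp : p.Prime) (k : ℕ) :
    ∑ j ∈ Finset.range (p ^ k), ((binomCount p j : ℝ))⁻¹ ≤ ((p + 1 : ℝ) / 2) ^ k := by
  induction k with
  | zero =>
    simp only [pow_zero, Finset.range_one, Finset.sum_singleton]
    exact inv_le_one_of_one_le₀ (by exact_mod_cast binomCount_pos hp 0)
  | succ k ih =>
    rw [pow_succ', sum_range_mul_eq]
    have hb : ∀ b : ℕ, ∑ c ∈ Finset.range p, ((binomCount p (p * b + c) : ℝ))⁻¹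
        ≤ ((p + 1 : ℝ) / 2) * ((binomCount p b : ℝ))⁻¹ := by
      intro b
      have hpos : (0 : ℝ) < binomCount p b := by exact_mod_cast binomCount_pos hp b
      obtain ⟨r, rfl⟩ : ∃ r, p = r + 1 := ⟨p - 1, by have := hp.pos; omega⟩
      rw [Finset.sum_range_succ']
      have h0 : ((binomCount (r + 1) ((r + 1) * b + 0) : ℝ))⁻¹
          ≤ ((binomCount (r + 1) b : ℝ))⁻¹ :=
        inv_anti₀ hpos (by exact_mod_cast binomCount_le_mul_add hp b hp.pos)
      have h1 : ∀ c ∈ Finset.range r, ((binomCount (r + 1) ((r + 1) * b + (c + 1)) : ℝ))⁻¹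
          ≤ (2 * (binomCount (r + 1) b : ℝ))⁻¹ := by
        intro c hc
        refine inv_anti₀ (by positivity) ?_
        exact_mod_cast two_mul_binomCount_le hp b
          (Nat.succ_lt_succ (Finset.mem_range.1 hc)) (Nat.succ_pos c)
      have h2 := Finset.sum_le_card_nsmul _ _ _ h1
      rw [Finset.card_range, nsmul_eq_mul, mul_inv] at h2
      push_cast
      linarith
    calc _ ≤ ∑ b ∈ Finset.range (p ^ k), ((p + 1 : ℝ) / 2) * ((binomCount p b : ℝ))⁻¹ :=
          Finset.sum_le_sum fun b _ => hb b
      _ ≤ ((p + 1 : ℝ) / 2) * ((p + 1 : ℝ) / 2) ^ k := by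
          rw [← Finset.mul_sum]; gcongr
      _ = _ := (pow_succ' _ _).symm

/-- Cesàro averages of a nonnegative sequence tend to `0` as soon as they do so along the powers
of some `p ≥ 2`. -/
lemma tendsto_average_zero_of_pow {p : ℕ} (hp : 2 ≤ p) {u : ℕ → ℝ} (hu : ∀ j, 0 ≤ u j)
    (h : Tendsto (fun k : ℕ => ((p : ℝ) ^ k)⁻¹ * ∑ j ∈ Finset.range (p ^ k), u j) atTop (𝓝 0)) :
    Tendsto (fun n : ℕ => (n : ℝ)⁻¹ * ∑ j ∈ Finset.range n, u j) atTop (𝓝 0) := by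
  have hlog : Tendsto (fun n : ℕ => Nat.log p n + 1) atTop atTop := by
    refine tendsto_atTop_mono (fun n => Nat.le_succ _) ?_
    refine tendsto_atTop_atTop.2 fun b => ⟨p ^ b, fun a ha => ?_⟩
    have : 0 < p ^ b := pow_pos (by omega) b
    exact (Nat.le_log_iff_pow_le hp (by omega)).2 ha
  have h2 := (h.comp hlog).const_mul (p : ℝ)
  rw [mul_zero] at h2
  refine squeeze_zero' (Eventually.of_forall fun n =>
    mul_nonneg (by positivity) (Finset.sum_nonneg fun j _ => hu j)) ?_ h2
  filter_upwards [eventually_ge_atTop 1] with n hn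
  have hlt : n < p ^ (Nat.log p n + 1) := Nat.lt_pow_succ_log_self hp n
  have hle : p ^ Nat.log p n ≤ n := Nat.pow_log_le_self p (by omega)
  have hp0 : (0 : ℝ) < p := by positivity
  have e : (p : ℝ) * ((p : ℝ) ^ (Nat.log p n + 1))⁻¹ = ((p : ℝ) ^ Nat.log p n)⁻¹ := by
    rw [pow_succ', mul_inv, mul_inv_cancel_left₀ hp0.ne']
  simp only [Function.comp_apply]
  rw [← mul_assoc, e]
  have hle' : ((p : ℝ) ^ Nat.log p n) ≤ n := by exact_mod_cast hle
  refine mul_le_mul (inv_anti₀ (by positivity) hle') ?_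
    (Finset.sum_nonneg fun j _ => hu j) (by positivity)
  exact Finset.sum_le_sum_of_subset_of_nonneg
    (Finset.range_subset_range.2 hlt.le) fun j _ _ => hu j

/-- If `u j ≤ 1 / binomCount p (j / p ^ m)` for every `m` and every `j` off the last `A` residues
modulo `p ^ m`, then the Cesàro averages of `u` vanish. -/
lemma tendsto_average_zero_of_binomCount {p : ℕ} (hp : p.Prime) {u : ℕ → ℝ} (hu : ∀ j, 0 ≤ u j)
    (hu1 : ∀ j, u j ≤ 1) (A : ℕ)
    (h : ∀ m l q : ℕ, l + A < p ^ m → u (p ^ m * q + l) ≤ ((binomCount p q : ℝ))⁻¹) :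
    Tendsto (fun n : ℕ => (n : ℝ)⁻¹ * ∑ j ∈ Finset.range n, u j) atTop (𝓝 0) := by
  refine tendsto_average_zero_of_pow hp.two_le hu ?_
  have hp0 : (0 : ℝ) < p := by exact_mod_cast hp.pos
  have hp2 : (2 : ℝ) ≤ p := by exact_mod_cast hp.two_le
  have bound : ∀ m k : ℕ, ((p : ℝ) ^ (m + k))⁻¹ * ∑ j ∈ Finset.range (p ^ (m + k)), u j
      ≤ (3 / 4 : ℝ) ^ k + (A + 1) * (1 / 2 : ℝ) ^ m := by
    intro m k
    have h1 : ∀ q : ℕ, ∑ l ∈ Finset.range (p ^ m), u (p ^ m * q + l)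
        ≤ (p : ℝ) ^ m * ((binomCount p q : ℝ))⁻¹ + (A + 1) := by
      intro q
      have hl : ∀ l ∈ Finset.range (p ^ m), u (p ^ m * q + l)
          ≤ ((binomCount p q : ℝ))⁻¹ + if p ^ m ≤ l + A then 1 else 0 := by
        intro l _
        split_ifs with hlA
        · have : (0 : ℝ) ≤ ((binomCount p q : ℝ))⁻¹ := by positivity
          linarith [hu1 (p ^ m * q + l)]
        · simpa using h m l q (not_le.1 hlA)
      refine (Finset.sum_le_sum hl).trans ?_
      rw [Finset.sum_add_distrib, Finset.sum_const, Finset.card_range, nsmul_eq_mul,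
        Finset.sum_boole]
      push_cast
      gcongr
      have : ((Finset.range (p ^ m)).filter fun l => p ^ m ≤ l + A)
          ⊆ Finset.Ico (p ^ m - A) (p ^ m) := by
        intro l hl
        simp only [Finset.mem_filter, Finset.mem_range, Finset.mem_Ico] at hl ⊢
        omega
      have h3 := Finset.card_le_card this
      rw [Nat.card_Ico] at h3
      have h4 : ((Finset.range (p ^ m)).filter fun l => p ^ m ≤ l + A).card ≤ A + 1 := by omega
      exact_mod_cast h4
    have hsum : ∑ j ∈ Finset.range (p ^ (m + k)), u j
        ≤ (p : ℝ) ^ m * ((p + 1 : ℝ) / 2) ^ k + (A + 1) * (p : ℝ) ^ k := by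
      rw [pow_add, sum_range_mul_eq]
      refine (Finset.sum_le_sum fun q _ => h1 q).trans ?_
      rw [Finset.sum_add_distrib, ← Finset.mul_sum, Finset.sum_const, Finset.card_range,
        nsmul_eq_mul]
      push_cast
      have := sum_inv_binomCount_le hp k
      rw [mul_comm ((p : ℝ) ^ k)]
      gcongr
    calc _ ≤ ((p : ℝ) ^ (m + k))⁻¹ *
          ((p : ℝ) ^ m * ((p + 1 : ℝ) / 2) ^ k + (A + 1) * (p : ℝ) ^ k) := by gcongr
      _ = (((p + 1 : ℝ) / 2) / p) ^ k + (A + 1) * (1 / p : ℝ) ^ m := by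
          rw [pow_add]; simp only [div_pow, one_pow]; field_simp
      _ ≤ _ := by
          have e1 : ((p + 1 : ℝ) / 2) / p ≤ 3 / 4 := by
            rw [div_div, div_le_div_iff₀ (by positivity) (by norm_num)]; linarith
          have e2 : (1 / p : ℝ) ≤ 1 / 2 := one_div_le_one_div_of_le (by norm_num) hp2
          gcongr
  have hlim : Tendsto (fun k : ℕ => (3 / 4 : ℝ) ^ (k - k / 2) + (A + 1) * (1 / 2 : ℝ) ^ (k / 2))
      atTop (𝓝 0) := by
    have d1 : Tendsto (fun k : ℕ => k - k / 2) atTop atTop :=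
      tendsto_atTop_mono (fun k => by omega) (Nat.tendsto_div_const_atTop (n := 2) (by norm_num))
    have d2 : Tendsto (fun k : ℕ => k / 2) atTop atTop :=
      Nat.tendsto_div_const_atTop (n := 2) (by norm_num)
    have := ((tendsto_pow_atTop_nhds_zero_of_lt_one (r := (3 / 4 : ℝ)) (by norm_num)
      (by norm_num)).comp d1).add (((tendsto_pow_atTop_nhds_zero_of_lt_one (r := (1 / 2 : ℝ))
      (by norm_num) (by norm_num)).comp d2).const_mul ((A : ℝ) + 1))
    simpa using this
  refine squeeze_zero (fun k => mul_nonneg (by positivity) (Finset.sum_nonneg fun j _ => hu j))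
    (fun k => ?_) hlim
  have := bound (k / 2) (k - k / 2)
  rwa [show k / 2 + (k - k / 2) = k by omega] at this

section Diffusion

variable {M : Type*} [AddCommGroup M]

/-- The endomorphism `e` applied in every coordinate of a bi-infinite sequence. -/
def coordEnd (e : AddMonoid.End M) : AddMonoid.End (ℤ → M) where
  toFun a := fun i => e (a i)
  map_zero' := by ext; simp
  map_add' a b := by ext; simp

/-- The endomorphism `r` applied in every coordinate, followed by a translation by one. -/
def shiftEnd (r : AddMonoid.End M) : AddMonoid.End (ℤ → M) where
  toFun a := fun i => r (a (i - 1))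
  map_zero' := by ext; simp
  map_add' a b := by ext; simp

lemma End_mul_apply (f g : AddMonoid.End M) (x : M) : (f * g) x = f (g x) := rfl

lemma End_add_apply (f g : AddMonoid.End M) (x : M) : (f + g) x = f x + g x := rfl

lemma End_sum_apply {ι : Type*} (S : Finset ι) (f : ι → AddMonoid.End M) (x : M) :
    (∑ i ∈ S, f i) x = ∑ i ∈ S, f i x := by
  classical
  induction S using Finset.induction_on with
  | empty => rfl
  | insert i S hi ih => rw [Finset.sum_insert hi, Finset.sum_insert hi, End_add_apply, ih]

lemma coordEnd_pow_apply (e : AddMonoid.End M) (n : ℕ) (a : ℤ → M) (i : ℤ) :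
    (coordEnd e ^ n) a i = (e ^ n) (a i) := by
  induction n generalizing a with
  | zero => rfl
  | succ n ih =>
    rw [pow_succ, pow_succ, End_mul_apply, End_mul_apply, ih]
    rfl

lemma shiftEnd_pow_apply (r : AddMonoid.End M) (n : ℕ) (a : ℤ → M) (i : ℤ) :
    (shiftEnd r ^ n) a i = (r ^ n) (a (i - n)) := by
  induction n generalizing a with
  | zero => simp
  | succ n ih =>
    rw [pow_succ, pow_succ, End_mul_apply, End_mul_apply, ih]
    change (r ^ n) (r (a (i - n - 1))) = _
    congr 3
    push_cast
    ring

lemma commute_coordEnd_shiftEnd {e r : AddMonoid.End M} (h : Commute e r) :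
    Commute (coordEnd e) (shiftEnd r) := by
  ext a i
  exact DFunLike.congr_fun h (a (i - 1))

lemma End_pow_injective {f : AddMonoid.End M} (hf : Function.Injective f) (n : ℕ) :
    Function.Injective (f ^ n : AddMonoid.End M) := by
  rw [AddMonoid.End.coe_pow]
  exact hf.iterate n

/-- On elements of order `p`, raising `x + y` to the power `p ^ m * q` amounts to raising
`x ^ p ^ m + y ^ p ^ m` to the power `q`. -/
lemma add_pow_prime_pow_mul_apply {N : Type*} [AddCommGroup N] {p : ℕ} (hp : p.Prime)
    {x y : AddMonoid.End N} (h : Commute x y) (m q : ℕ) {v : N} (hv : p • v = 0) :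
    ((x + y) ^ (p ^ m * q)) v = ((x ^ p ^ m + y ^ p ^ m) ^ q) v := by
  obtain ⟨r, hr⟩ := h.exists_add_pow_prime_pow_eq hp m
  rw [pow_mul, hr]
  induction q generalizing v with
  | zero => rfl
  | succ q ih =>
    rw [pow_succ, pow_succ, End_mul_apply, End_mul_apply]
    have hpv : ((p : AddMonoid.End N) * x * y * r) v = 0 := by
      rw [mul_assoc, mul_assoc, End_mul_apply, AddMonoid.End.natCast_apply, ← map_nsmul,
        hv, map_zero]
    have e1 : (x ^ p ^ m + y ^ p ^ m + (p : AddMonoid.End N) * x * y * r) v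
        = (x ^ p ^ m + y ^ p ^ m) v := by
      rw [End_add_apply, hpv, add_zero]
    rw [e1, ih]
    rw [← map_nsmul, hv, map_zero]

lemma eq_zero_of_nsmul_nsmul {N : Type*} [AddCommGroup N] {p c : ℕ} (hp : p.Prime)
    (hc : ¬ p ∣ c) {v : N} (hv : p • v = 0) (h : c • v = 0) : v = 0 := by
  have h1 := addOrderOf_dvd_of_nsmul_eq_zero hv
  have h2 := addOrderOf_dvd_of_nsmul_eq_zero h
  have h3 : addOrderOf v ∣ 1 := by
    rw [← (Nat.Prime.coprime_iff_not_dvd hp).2 hc]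
    exact Nat.dvd_gcd h1 h2
  exact AddMonoid.addOrderOf_eq_one_iff.1 (Nat.dvd_one.1 h3)

/-- The iterates of a linear recursion in which the supports of order-`p` elements spread out like
the rows of Pascal's triangle modulo `p`. -/
lemma binomCount_le_ncard_support {p : ℕ} (hp : p.Prime) {e r : AddMonoid.End M}
    (her : Commute e r) (he : Function.Injective e) (hr : Function.Injective r)
    (b : ℤ → M) (hpb : p • b = 0) (hb0 : b ≠ 0) (c : ℤ) (A : ℕ)
    (hsupp : ∀ i, b i ≠ 0 → c ≤ i ∧ i ≤ c + A) (m l q : ℕ) (hl : l + A < p ^ m) :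
    binomCount p q ≤ (Function.support
      (((coordEnd e + shiftEnd r) ^ (p ^ m * q + l)) b)).ncard := by
  have hsupp_iter : ∀ n : ℕ, ((coordEnd e + shiftEnd r) ^ n) b ≠ 0 ∧
      ∀ i, ((coordEnd e + shiftEnd r) ^ n) b i ≠ 0 → c ≤ i ∧ i ≤ c + A + n := by
    intro n
    induction n with
    | zero => exact ⟨hb0, fun i hi => by simpa using hsupp i hi⟩
    | succ n ih =>
      set w := ((coordEnd e + shiftEnd r) ^ n) b with hw
      have hstep : ∀ i, ((coordEnd e + shiftEnd r) ^ (n + 1)) b i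
          = e (w i) + r (w (i - 1)) := by
        intro i
        rw [pow_succ', End_mul_apply]
        rfl
      constructor
      · intro h0
        refine ih.1 (funext fun i => ?_)
        by_contra hi
        have hlow : ∀ k : ℕ, w (c - 1 + k) = 0 := by
          intro k
          induction k with
          | zero =>
            by_contra h
            have := (ih.2 _ h).1
            push_cast at this
            omega
          | succ k ihk =>
            have h1 := hstep (c - 1 + (k + 1 : ℕ))
            rw [show c - 1 + ((k + 1 : ℕ) : ℤ) - 1 = c - 1 + k by push_cast; ring, ihk, map_zero,
              add_zero, h0] at h1
            exact he (by rw [map_zero]; exact h1.symm)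
        have hci := (ih.2 i hi).1
        refine hi ?_
        have := hlow (i - (c - 1)).toNat
        rwa [show c - 1 + ((i - (c - 1)).toNat : ℤ) = i by omega] at this
      · intro i hi
        rw [hstep] at hi
        by_cases h1 : w i = 0
        · have h2 : w (i - 1) ≠ 0 := fun h2 => hi (by rw [h1, h2, map_zero, map_zero, add_zero])
          have := ih.2 _ h2
          push_cast
          omega
        · have := ih.2 _ h1
          push_cast
          omega
  set w := ((coordEnd e + shiftEnd r) ^ l) b with hw
  have hpw : p • w = 0 := by rw [hw, ← map_nsmul, hpb, map_zero]
  have hfin : (Function.support (((coordEnd e + shiftEnd r) ^ (p ^ m * q + l)) b)).Finite :=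
    (Set.finite_Icc c (c + A + (p ^ m * q + l : ℕ))).subset fun i hi => (hsupp_iter _).2 i hi
  obtain ⟨i₀, hi₀⟩ : ∃ i, w i ≠ 0 := by
    by_contra! h
    exact (hsupp_iter l).1 (funext h)
  have hP : (0 : ℤ) < (p : ℤ) ^ m := by have := hp.pos; positivity
  have hl' : (l : ℤ) + A < (p : ℤ) ^ m := by exact_mod_cast hl
  have hterm : ∀ t : ℕ, t ≤ q → ((coordEnd e + shiftEnd r) ^ (p ^ m * q + l)) b
      (i₀ + ((p ^ m * t : ℕ) : ℤ))
        = q.choose t • (e ^ (p ^ m * (q - t))) ((r ^ (p ^ m * t)) (w i₀)) := by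
    intro t ht
    have hcomm := (commute_coordEnd_shiftEnd her).pow_pow (p ^ m) (p ^ m)
    rw [pow_add, End_mul_apply, ← hw,
      add_pow_prime_pow_mul_apply hp (commute_coordEnd_shiftEnd her) m q hpw, hcomm.add_pow]
    rw [End_sum_apply, Finset.sum_apply, Finset.sum_eq_single (q - t)]
    · rw [← Nat.cast_comm, End_mul_apply, AddMonoid.End.natCast_apply, Pi.smul_apply,
        End_mul_apply, ← pow_mul, ← pow_mul, coordEnd_pow_apply, shiftEnd_pow_apply,
        Nat.sub_sub_self ht, Nat.choose_symm ht, add_sub_cancel_right]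
    · intro t' ht' hne
      rw [← Nat.cast_comm, End_mul_apply, AddMonoid.End.natCast_apply, Pi.smul_apply,
        End_mul_apply, ← pow_mul, ← pow_mul, coordEnd_pow_apply, shiftEnd_pow_apply]
      have hz : w (i₀ + ((p ^ m * t : ℕ) : ℤ) - ((p ^ m * (q - t') : ℕ) : ℤ)) = 0 := by
        by_contra h
        have b1 := (hsupp_iter l).2 _ h
        have b2 := (hsupp_iter l).2 _ hi₀
        have ht'q : t' ≤ q := by simpa [Nat.lt_succ_iff] using ht'
        push_cast [Nat.cast_sub ht'q] at b1
        have hd : (t : ℤ) - (q - t') ≠ 0 := by omega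
        rcases lt_or_gt_of_ne hd with hd | hd
        · nlinarith
        · nlinarith
      rw [hz, map_zero, map_zero, smul_zero]
    · intro h
      exact absurd (Finset.mem_range.2 (by omega)) h
  rw [binomCount, ← Set.ncard_coe_finset]
  refine Set.ncard_le_ncard_of_injOn (fun t => i₀ + ((p ^ m * t : ℕ) : ℤ)) ?_ ?_ hfin
  · intro t ht
    simp only [Finset.coe_filter, Finset.mem_range, Set.mem_ofPred_eq] at ht
    rw [Function.mem_support, hterm t (Nat.lt_succ_iff.1 ht.1)]
    intro h
    refine hi₀ ?_
    have hpi : p • w i₀ = 0 := congrFun hpw i₀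
    rw [← map_nsmul, ← map_nsmul] at h
    have h1 := End_pow_injective he _ (h.trans (map_zero _).symm)
    have h2 := End_pow_injective hr _ (h1.trans (map_zero _).symm)
    exact eq_zero_of_nsmul_nsmul hp ht.2 hpi h2
  · intro t _ t' _ h
    have h' : p ^ m * t = p ^ m * t' := by
      have := add_left_cancel h
      exact_mod_cast this
    exact Nat.eq_of_mul_eq_mul_left (pow_pos hp.pos m) h'

/-- Along a recursion `a_{j+1} i = e (a_j i) + r (a_j (i - 1))` with commuting injective `e`, `r`,
the number of nonzero coordinates tends to infinity in density. -/
lemma tendsto_average_inv_ncard_support [Finite M] {e r : AddMonoid.End M}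
    (her : Commute e r) (he : Function.Injective e) (hr : Function.Injective r)
    (a : ℕ → ℤ → M) (hrec : ∀ j i, a (j + 1) i = e (a j i) + r (a j (i - 1)))
    (hfin : ∀ j, (Function.support (a j)).Finite) (ha0 : a 0 ≠ 0) :
    Tendsto (fun n : ℕ => (n : ℝ)⁻¹ * ∑ j ∈ Finset.range n,
      (((Function.support (a j)).ncard : ℝ) + 1)⁻¹) atTop (𝓝 0) := by
  have hpow : ∀ j, a j = ((coordEnd e + shiftEnd r) ^ j) (a 0) := by
    intro j
    induction j with
    | zero => rfl
    | succ j ih =>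
      rw [pow_succ', End_mul_apply, ← ih]
      exact funext fun i => hrec j i
  have hord : 0 < addOrderOf (a 0) := by
    refine addOrderOf_pos_iff.2 (isOfFinAddOrder_iff_nsmul_eq_zero.2
      ⟨Nat.card M, Nat.card_pos, funext fun i => ?_⟩)
    exact card_nsmul_eq_zero'
  have hord1 : addOrderOf (a 0) ≠ 1 := fun h => ha0 (AddMonoid.addOrderOf_eq_one_iff.1 h)
  obtain ⟨p, hp, k, hk⟩ := Nat.exists_prime_and_dvd hord1
  have hk0 : 0 < k := Nat.pos_of_ne_zero fun h => by rw [h, mul_zero] at hk; omega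
  have hb0 : k • a 0 ≠ 0 := by
    intro h
    have := Nat.le_of_dvd hk0 (addOrderOf_dvd_of_nsmul_eq_zero h)
    rw [hk] at this
    nlinarith [hp.two_le]
  have hpb : p • (k • a 0) = 0 := by rw [← mul_nsmul', ← hk, addOrderOf_nsmul_eq_zero]
  obtain ⟨c, A, hcA⟩ : ∃ (c : ℤ) (A : ℕ), ∀ i, (k • a 0) i ≠ 0 → c ≤ i ∧ i ≤ c + A := by
    obtain ⟨c, hc⟩ := (hfin 0).bddBelow
    obtain ⟨d, hd⟩ := (hfin 0).bddAbove
    refine ⟨c, (d - c).toNat, fun i hi => ?_⟩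
    have hi' : i ∈ Function.support (a 0) := fun h => hi (by rw [Pi.smul_apply, h, smul_zero])
    have h1 := hc hi'
    have h2 := hd hi'
    omega
  refine tendsto_average_zero_of_binomCount hp (fun j => by positivity)
    (fun j => inv_le_one_of_one_le₀ (by norm_cast; omega)) A fun m l q hl => ?_
  refine inv_anti₀ (by exact_mod_cast binomCount_pos hp q) ?_
  have h1 := binomCount_le_ncard_support hp her he hr (k • a 0) hpb hb0 c A hcA m l q hl
  have h2 : (Function.support (((coordEnd e + shiftEnd r) ^ (p ^ m * q + l)) (k • a 0))).ncard
      ≤ (Function.support (a (p ^ m * q + l))).ncard := by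
    refine Set.ncard_le_ncard (fun i hi h => hi ?_) (hfin _)
    rw [map_nsmul, ← hpow, Pi.smul_apply, h, smul_zero]
  exact_mod_cast h1.trans (h2.trans (Nat.le_succ _))

end Diffusion

section MarkovGroup

lemma TMC_splice {G : Type*} {E : Set (G × G)} {x y : ℤ → G} (hx : x ∈ TMC E) (hy : y ∈ TMC E)
    (n m : ℤ) (h : (x n, y (m + 1)) ∈ E) :
    (fun t => if t ≤ n then x t else y (t - n + m)) ∈ TMC E := by
  intro t
  rcases lt_trichotomy t n with ht | rfl | ht
  · simpa only [if_pos ht.le, if_pos (show t + 1 ≤ n by omega)] using hx t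
  · simpa only [if_pos le_rfl, if_neg (show ¬ t + 1 ≤ t by omega),
      show t + 1 - t + m = m + 1 by ring] using h
  · have := hy (t - n + m)
    simpa only [if_neg (show ¬ t ≤ n by omega), if_neg (show ¬ t + 1 ≤ n by omega),
      show t + 1 - n + m = t - n + m + 1 by ring] using this

lemma TMC_shift {G : Type*} {E : Set (G × G)} {x : ℤ → G} (hx : x ∈ TMC E) (m : ℤ) :
    (fun t => x (t + m)) ∈ TMC E := by
  intro t
  have := hx (t + m)
  rwa [show t + m + 1 = t + 1 + m by ring] at this

lemma EveryLetterOccurs.exists_edge_point {G : Type*} {E : Set (G × G)} (hE : EveryLetterOccurs E)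
    {a b : G} (h : (a, b) ∈ E) : ∃ x ∈ TMC E, x 0 = a ∧ x 1 = b := by
  obtain ⟨x, hx, i, rfl⟩ := hE a
  obtain ⟨y, hy, j, rfl⟩ := hE b
  refine ⟨_, TMC_splice (TMC_shift hx i) (TMC_shift hy j) 0 (-1) (by simpa using h), ?_, ?_⟩
  · simp
  · simp

lemma SC.rule_mem {G : Type*} {E : Set (G × G)} {φ : G → G → G} (h : SC E φ)
    (hE : EveryLetterOccurs E) {a b a' b' : G} (h1 : (a, b) ∈ E) (h2 : (a', b') ∈ E) :
    (φ a a', φ b b') ∈ E := by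
  obtain ⟨x, hx, rfl, rfl⟩ := hE.exists_edge_point h1
  obtain ⟨y, hy, rfl, rfl⟩ := hE.exists_edge_point h2
  exact h x hx y hy 0

open scoped Pointwise in
/-- A finite subset of an abelian group closed under an affine operation is a coset: its
differences are exactly its stabilizer. -/
lemma sub_mem_stabilizer_of_affine {A : Type*} [AddCommGroup A] [Finite A] {S : Set A}
    {e r : A →+ A} (he : Function.Injective e) (hr : Function.Injective r) (c : A)
    (hS : ∀ p ∈ S, ∀ q ∈ S, e p + r q + c ∈ S) :
    (∀ p ∈ S, ∀ q ∈ S, p - q ∈ AddAction.stabilizer A S) ∧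
    (∀ v ∈ AddAction.stabilizer A S, e v ∈ AddAction.stabilizer A S) ∧
    (∀ v ∈ AddAction.stabilizer A S, r v ∈ AddAction.stabilizer A S) := by
  have hfin : S.Finite := Set.toFinite S
  have surj : ∀ f : A → A, Function.Injective f → (∀ p ∈ S, f p ∈ S) → ∀ z ∈ S, ∃ p ∈ S, f p = z := by
    intro f hf hmaps z hz
    exact ((hfin.injOn_iff_bijOn_of_mapsTo hmaps).1 hf.injOn).surjOn hz
  have stab : ∀ v, (∀ z ∈ S, v + z ∈ S) → v ∈ AddAction.stabilizer A S := by
    intro v hv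
    rw [AddAction.mem_stabilizer_iff]
    refine Set.Subset.antisymm ?_ ?_
    · rintro _ ⟨z, hz, rfl⟩
      exact hv z hz
    · intro z hz
      exact surj (fun z => v + z) (add_right_injective v) hv z hz
  have hrmem : ∀ p ∈ S, ∀ q ∈ S, r (p - q) ∈ AddAction.stabilizer A S := by
    intro p hp q hq
    refine stab _ fun z hz => ?_
    obtain ⟨w, hw, rfl⟩ := surj (fun w => e w + r q + c)
      (fun w w' h => he (by simpa using h)) (fun w hw => hS w hw q hq) z hz
    have := hS w hw p hp
    rwa [show r (p - q) + (e w + r q + c) = e w + r p + c by rw [map_sub]; abel]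
  have hemem : ∀ p ∈ S, ∀ q ∈ S, e (p - q) ∈ AddAction.stabilizer A S := by
    intro p hp q hq
    refine stab _ fun z hz => ?_
    obtain ⟨w, hw, rfl⟩ := surj (fun w => e q + r w + c)
      (fun w w' h => hr (by simpa using h)) (fun w hw => hS q hq w hw) z hz
    have := hS p hp w hw
    rwa [show e (p - q) + (e q + r w + c) = e p + r w + c by rw [map_sub]; abel]
  rcases S.eq_empty_or_nonempty with rfl | ⟨z₀, hz₀⟩
  · have htop : ∀ v : A, v ∈ AddAction.stabilizer A (∅ : Set A) := by simp
    exact ⟨fun _ _ _ _ => htop _, fun _ _ => htop _, fun _ _ => htop _⟩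
  have hmem : ∀ v ∈ AddAction.stabilizer A S, v + z₀ ∈ S := by
    intro v hv
    rw [AddAction.mem_stabilizer_iff] at hv
    rw [← hv]
    exact ⟨z₀, hz₀, rfl⟩
  have heq : ∀ p ∈ S, ∀ q ∈ S, p - q ∈ AddAction.stabilizer A S := by
    have h1 : (AddAction.stabilizer A S : Set A) ⊆ S - S := fun v hv =>
      ⟨v + z₀, hmem v hv, z₀, hz₀, by simp⟩
    have h2 : (S - S).ncard ≤ (AddAction.stabilizer A S : Set A).ncard := by
      refine Set.ncard_le_ncard_of_injOn r ?_ hr.injOn (Set.toFinite _)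
      rintro _ ⟨p, hp, q, hq, rfl⟩
      exact hrmem p hp q hq
    have h3 := Set.eq_of_subset_of_ncard_le h1 h2 (Set.toFinite _)
    intro p hp q hq
    rw [← SetLike.mem_coe, h3]
    exact ⟨p, hp, q, hq, rfl⟩
  refine ⟨heq, fun v hv => ?_, fun v hv => ?_⟩
  · have := hemem _ (hmem v hv) _ hz₀
    rwa [add_sub_cancel_right] at this
  · have := hrmem _ (hmem v hv) _ hz₀
    rwa [add_sub_cancel_right] at this

variable {K : Type*} [AddCommGroup K]

/-- The letters that can be reached from `0` along a finite path of the Markov group of `V`. -/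
def reachable (V : AddSubgroup (K × K)) : AddSubgroup K where
  carrier := {a | ∃ u : ℕ → K, u 0 = a ∧ (∀ n, (u (n + 1), u n) ∈ V) ∧ ∃ k, ∀ n, k ≤ n → u n = 0}
  zero_mem' := ⟨fun _ => 0, rfl, fun _ => V.zero_mem, 0, fun _ _ => rfl⟩
  add_mem' := by
    rintro _ _ ⟨u, rfl, hu, k, hk⟩ ⟨w, rfl, hw, l, hl⟩
    refine ⟨fun n => u n + w n, rfl, fun n => V.add_mem (hu n) (hw n), max k l, fun n hn => ?_⟩
    simp only
    rw [hk n ((le_max_left _ _).trans hn), hl n ((le_max_right _ _).trans hn), add_zero]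
  neg_mem' := by
    rintro _ ⟨u, rfl, hu, k, hk⟩
    exact ⟨fun n => -u n, rfl, fun n => V.neg_mem (hu n), k, fun n hn => by simp [hk n hn]⟩

lemma reachable_of_fst {V : AddSubgroup (K × K)} {a b : K} (ha : a ∈ reachable V)
    (h : (a, b) ∈ V) : b ∈ reachable V := by
  obtain ⟨u, rfl, hu, k, hk⟩ := ha
  refine ⟨fun n => n.casesOn b u, rfl, fun n => ?_, k + 1, fun n hn => ?_⟩
  · cases n with
    | zero => exact h
    | succ n => exact hu n
  · cases n with
    | zero => omega
    | succ n => exact hk n (by omega)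

lemma reachable_of_snd [Finite K] {V : AddSubgroup (K × K)} (h1 : ∀ a, ∃ b, (a, b) ∈ V)
    (h2 : ∀ b, ∃ a, (a, b) ∈ V) {a b : K} (hb : b ∈ reachable V)
    (h : (a, b) ∈ V) : a ∈ reachable V := by
  set f : V →+ K := (AddMonoidHom.fst K K).comp V.subtype with hf
  set g : V →+ K := (AddMonoidHom.snd K K).comp V.subtype with hg
  have hfs : Function.Surjective f := fun a => by
    obtain ⟨b, hb⟩ := h1 a
    exact ⟨⟨(a, b), hb⟩, rfl⟩
  have hgs : Function.Surjective g := fun b => by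
    obtain ⟨a, ha⟩ := h2 b
    exact ⟨⟨(a, b), ha⟩, rfl⟩
  have hle : (reachable V).comap f ≤ (reachable V).comap g := by
    rintro ⟨⟨x, y⟩, hxy⟩ hx
    exact reachable_of_fst (V := V) (a := x) hx hxy
  have hidx : ((reachable V).comap f).index = ((reachable V).comap g).index := by
    rw [AddSubgroup.index_comap_of_surjective _ hfs, AddSubgroup.index_comap_of_surjective _ hgs]
  have heq : (reachable V).comap f = (reachable V).comap g := by
    refine le_antisymm hle ?_
    have := AddSubgroup.relIndex_mul_index hle
    rw [hidx] at this
    have hne : ((reachable V).comap g).index ≠ 0 := AddSubgroup.FiniteIndex.index_ne_zero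
    exact AddSubgroup.relIndex_eq_one.1 ((mul_eq_right₀ hne).1 this)
  have : (⟨(a, b), h⟩ : V) ∈ (reachable V).comap f := by
    rw [heq]
    exact hb
  exact this

/-- Reachability from `0` along reversed paths is the same as reachability from `0`. -/
lemma exists_path_to_zero [Finite K] {V : AddSubgroup (K × K)} (h1 : ∀ a, ∃ b, (a, b) ∈ V)
    (h2 : ∀ b, ∃ a, (a, b) ∈ V) {a : K} (ha : a ∈ reachable V) :
    ∃ u : ℕ → K, u 0 = a ∧ (∀ n, (u n, u (n + 1)) ∈ V) ∧ ∃ k, ∀ n, k ≤ n → u n = 0 := by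
  set W : AddSubgroup (K × K) := V.comap (AddEquiv.prodComm : K × K ≃+ K × K).toAddMonoidHom
    with hW
  have hmem : ∀ x y, (x, y) ∈ W ↔ (y, x) ∈ V := fun x y => Iff.rfl
  have key : a ∈ reachable W := by
    obtain ⟨u, rfl, hu, k, hk⟩ := ha
    have : ∀ n, u (k - n) ∈ reachable W := by
      intro n
      induction n with
      | zero =>
        rw [hk (k - 0) (by omega)]
        exact AddSubgroup.zero_mem _
      | succ n ih =>
        rcases Nat.lt_or_ge n k with hn | hn
        · refine reachable_of_snd (V := W) (b := u (k - n)) h2 h1 ih ((hmem _ _).2 ?_)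
          have := hu (k - (n + 1))
          rwa [show k - (n + 1) + 1 = k - n by omega] at this
        · rwa [show k - (n + 1) = k - n by omega]
    simpa using this k
  obtain ⟨u, hu0, hu, hk⟩ := key
  exact ⟨u, hu0, fun n => hu n, hk⟩

lemma map_mem_reachable {V : AddSubgroup (K × K)} {e : K →+ K}
    (he : ∀ a b, (a, b) ∈ V → (e a, e b) ∈ V) {a : K} (ha : a ∈ reachable V) :
    e a ∈ reachable V := by
  obtain ⟨u, rfl, hu, k, hk⟩ := ha
  exact ⟨fun n => e (u n), rfl, fun n => he _ _ (hu n), k, fun n hn => by simp [hk n hn]⟩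

lemma mem_reachable_of_mem_TMC [Finite K] {V : AddSubgroup (K × K)} (h1 : ∀ a, ∃ b, (a, b) ∈ V)
    (h2 : ∀ b, ∃ a, (a, b) ∈ V) {h : ℤ → K} (hh : h ∈ TMC (V : Set (K × K)))
    (h0 : h 0 ∈ reachable V) (t : ℤ) : h t ∈ reachable V := by
  induction t using Int.induction_on with
  | zero => exact h0
  | succ t ih => exact reachable_of_fst ih (hh _)
  | pred t ih =>
    refine reachable_of_snd h1 h2 ih ?_
    have := hh (-(t : ℤ) - 1)
    rwa [sub_add_cancel] at this

/-- A point of the Markov group through a reachable letter agrees, on any bounded window, with a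
homoclinic point. -/
lemma exists_homoclinic [Finite K] {V : AddSubgroup (K × K)} (h1 : ∀ a, ∃ b, (a, b) ∈ V)
    (h2 : ∀ b, ∃ a, (a, b) ∈ V) {h : ℤ → K} (hh : h ∈ TMC (V : Set (K × K)))
    (h0 : h 0 ∈ reachable V) (q : ℕ) :
    ∃ g ∈ TMC (V : Set (K × K)), (Function.support g).Finite ∧
      ∀ t : ℤ, -q ≤ t → t ≤ q → g t = h t := by
  obtain ⟨u, hu0, hu, k, hk⟩ := mem_reachable_of_mem_TMC h1 h2 hh h0 (-q)
  obtain ⟨w, hw0, hw, l, hl⟩ := exists_path_to_zero h1 h2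
    (mem_reachable_of_mem_TMC h1 h2 hh h0 q)
  refine ⟨fun t => if t < -q then u (-q - t).toNat else if t ≤ q then h t else w (t - q).toNat,
    fun t => ?_, ?_, fun t ht1 ht2 => ?_⟩
  · by_cases c1 : t < -q
    · by_cases c2 : t + 1 < -q
      · simp only [if_pos c1, if_pos c2]
        have := hu (-q - (t + 1)).toNat
        rwa [show (-(q : ℤ) - (t + 1)).toNat + 1 = (-q - t).toNat by omega] at this
      · have ht : t + 1 = -q := by omega
        simp only [if_pos c1, if_neg c2, if_pos (show t + 1 ≤ q by omega)]
        have := hu 0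
        rw [hu0, zero_add, ← ht] at this
        rwa [show (-(q : ℤ) - t).toNat = 1 by omega]
    · by_cases c2 : t + 1 ≤ q
      · simp only [if_neg c1, if_neg (show ¬ t + 1 < -(q : ℤ) by omega), if_pos c2,
          if_pos (show t ≤ q by omega)]
        exact hh t
      · by_cases c3 : t ≤ q
        · have ht : t = q := by omega
          simp only [if_neg c1, if_neg (show ¬ t + 1 < -(q : ℤ) by omega), if_neg c2, if_pos c3]
          have := hw 0
          rwa [hw0, zero_add, ← ht, show 1 = (t + 1 - (q : ℤ)).toNat by omega] at this
        · simp only [if_neg c1, if_neg (show ¬ t + 1 < -(q : ℤ) by omega), if_neg c2, if_neg c3]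
          have := hw (t - q).toNat
          rwa [show (t - (q : ℤ)).toNat + 1 = (t + 1 - q).toNat by omega] at this
  · refine (Set.finite_Icc (-q - k : ℤ) (q + l)).subset fun t ht => ?_
    rw [Function.mem_support] at ht
    by_contra hc
    rw [Set.mem_Icc] at hc
    refine ht ?_
    by_cases c1 : t < -q
    · rw [if_pos c1]
      exact hk _ (by omega)
    · rw [if_neg c1, if_neg (by omega)]
      exact hl _ (by omega)
  · simp only [if_neg (not_lt.2 ht1), if_pos ht2]

end MarkovGroup

section CompleteConnections

variable {G : Type*} [Fintype G] [MeasurableSpace G] [MeasurableSingletonClass G]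

/-- The mass of the cylinder through `x` on the coordinates in `[a, b)`. -/
noncomputable def cylMass (μ : Measure (ℤ → G)) (x : ℤ → G) (a b : ℤ) : ℝ :=
  μ.real {y | ∀ t, a ≤ t → t < b → y t = x t}

omit [Fintype G] in
lemma measurableSet_window (x : ℤ → G) (a b : ℤ) :
    MeasurableSet {y : ℤ → G | ∀ t, a ≤ t → t < b → y t = x t} := by
  have : {y : ℤ → G | ∀ t, a ≤ t → t < b → y t = x t}
      = ⋂ (t : ℤ) (_ : a ≤ t) (_ : t < b), (fun y => y t) ⁻¹' {x t} := by
    ext y; simp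
  rw [this]
  exact MeasurableSet.iInter fun t => MeasurableSet.iInter fun _ => MeasurableSet.iInter fun _ =>
    measurable_pi_apply t (measurableSet_singleton _)

omit [Fintype G] [MeasurableSingletonClass G] in
lemma measurable_translate (n : ℤ) : Measurable fun (x : ℤ → G) t => x (t + n) :=
  measurable_pi_lambda _ fun _ => measurable_pi_apply _

omit [Fintype G] [MeasurableSingletonClass G] in
lemma measurePreserving_translate {μ : Measure (ℤ → G)} (hμ : Measure.map shiftMap μ = μ) (n : ℤ) :
    MeasurePreserving (fun (x : ℤ → G) t => x (t + n)) μ μ := by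
  have h1 : MeasurePreserving (fun (x : ℤ → G) t => x (t + 1)) μ μ :=
    ⟨measurable_translate 1, hμ⟩
  have h2 : MeasurePreserving (fun (x : ℤ → G) t => x (t + -1)) μ μ := by
    refine ⟨measurable_translate _, ?_⟩
    conv_lhs => rw [← h1.map_eq]
    rw [Measure.map_map (measurable_translate _) (measurable_translate _)]
    convert Measure.map_id
    ext x t
    simp
  induction n using Int.induction_on with
  | zero =>
    simp only [add_zero]
    exact MeasurePreserving.id μ
  | succ n ih =>
    convert h1.comp ih using 3
    simp only [Function.comp_apply]
    ring_nf
  | pred n ih =>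
    convert h2.comp ih using 3
    simp only [Function.comp_apply]
    ring_nf

omit [Fintype G] in
lemma cyl_mass_eq {μ : Measure (ℤ → G)} (hμ : Measure.map shiftMap μ = μ) (x : ℤ → G) (a : ℤ)
    {m : ℕ} (w : Fin m → G) (hw : ∀ i : Fin m, w i = x (a + ((i : ℕ) : ℤ))) :
    (μ (cyl w)).toReal = cylMass μ x a (a + m) := by
  have hset : {y : ℤ → G | ∀ t, a ≤ t → t < a + m → y t = x t}
      = (fun (y : ℤ → G) t => y (t + a)) ⁻¹' cyl w := by
    ext y
    simp only [Set.mem_ofPred_eq, Set.mem_preimage, cyl]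
    constructor
    · intro h i
      rw [hw, h _ (by omega) (by have := i.2; omega), add_comm]
    · intro h t h1 h2
      have := h ⟨(t - a).toNat, by omega⟩
      rw [hw] at this
      simp only at this
      rwa [show ((t - a).toNat : ℤ) + a = t by omega, show a + ((t - a).toNat : ℤ) = t by omega]
        at this
  have hmeas : MeasurableSet (cyl w) := by
    have : cyl w = ⋂ i : Fin m, (fun y : ℤ → G => y ((i : ℕ) : ℤ)) ⁻¹' {w i} := by
      ext y; simp [cyl]
    rw [this]
    exact MeasurableSet.iInter fun i => measurable_pi_apply _ (measurableSet_singleton _)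
  rw [cylMass, measureReal_def, hset,
    (measurePreserving_translate hμ a).measure_preimage hmeas.nullMeasurableSet]

omit [Fintype G] [MeasurableSingletonClass G] in
lemma cylMass_congr (μ : Measure (ℤ → G)) {x y : ℤ → G} {a b : ℤ}
    (h : ∀ t, a ≤ t → t < b → x t = y t) : cylMass μ x a b = cylMass μ y a b := by
  unfold cylMass
  congr 1
  ext z
  exact forall_congr' fun t => forall_congr' fun h1 => forall_congr' fun h2 => by rw [h t h1 h2]

omit [Fintype G] [MeasurableSingletonClass G] in
lemma cylMass_nonneg (μ : Measure (ℤ → G)) (x : ℤ → G) (a b : ℤ) : 0 ≤ cylMass μ x a b :=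
  measureReal_nonneg

omit [Fintype G] [MeasurableSingletonClass G] in
lemma cylMass_anti (μ : Measure (ℤ → G)) [IsProbabilityMeasure μ] (x : ℤ → G) {a b b' : ℤ}
    (h : b ≤ b') : cylMass μ x a b' ≤ cylMass μ x a b :=
  measureReal_mono fun _ hy t h1 h2 => hy t h1 (h2.trans_le h)

omit [Fintype G] in
lemma cylMass_pos {E : Set (G × G)} {μ : Measure (ℤ → G)} (hμ : GoodMeasure E μ) {x : ℤ → G}
    (hx : x ∈ TMC E) (a b : ℤ) : 0 < cylMass μ x a b := by
  have := hμ.1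
  have key : ∀ m : ℕ, 0 < cylMass μ x a (a + m) := by
    intro m
    rw [← cyl_mass_eq hμ.2.1 x a (fun i : Fin m => x (a + ((i : ℕ) : ℤ))) fun _ => rfl]
    exact ENNReal.toReal_pos (hμ.2.2.2 m _ ⟨x, hx, a, fun _ => rfl⟩).ne' (measure_ne_top _ _)
  exact (key (b - a).toNat).trans_le (cylMass_anti μ x (by omega))

lemma cylMass_eq_sum_left (μ : Measure (ℤ → G)) [IsProbabilityMeasure μ] (x : ℤ → G) {a b : ℤ}
    (hab : a ≤ b) :
    cylMass μ x a b = ∑ c, cylMass μ (Function.update x (a - 1) c) (a - 1) b := by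
  unfold cylMass
  rw [← measureReal_iUnion_fintype]
  · congr 1
    ext y
    simp only [Set.mem_ofPred_eq, Set.mem_iUnion]
    constructor
    · intro h
      refine ⟨y (a - 1), fun t h1 h2 => ?_⟩
      rcases eq_or_ne t (a - 1) with rfl | hne
      · simp
      · rw [Function.update_of_ne hne]
        exact h t (by omega) h2
    · rintro ⟨c, h⟩ t h1 h2
      have := h t (by omega) h2
      rwa [Function.update_of_ne (by omega)] at this
  · intro c c' hne
    rw [Function.onFun, Set.disjoint_left]
    intro y hy hy'
    have e1 := hy (a - 1) le_rfl (by omega)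
    have e2 := hy' (a - 1) le_rfl (by omega)
    rw [Function.update_self] at e1 e2
    exact hne (e1.symm.trans e2)
  · exact fun c => measurableSet_window _ _ _

lemma measurableSet_TMC (E : Set (G × G)) : MeasurableSet (TMC E) := by
  have : TMC E = ⋂ t : ℤ, (fun x : ℤ → G => (x t, x (t + 1))) ⁻¹' E := by
    ext x; simp [TMC]
  rw [this]
  exact MeasurableSet.iInter fun t => ((measurable_pi_apply t).prodMk (measurable_pi_apply (t + 1)))
    E.toFinite.measurableSet

lemma exists_point_of_cylMass_pos {E : Set (G × G)} {μ : Measure (ℤ → G)} (hμ : GoodMeasure E μ)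
    {x : ℤ → G} {a b : ℤ} (h : 0 < cylMass μ x a b) :
    ∃ y ∈ TMC E, ∀ t, a ≤ t → t < b → y t = x t := by
  have := hμ.1
  by_contra! hc
  have hsub : {y : ℤ → G | ∀ t, a ≤ t → t < b → y t = x t} ⊆ (TMC E)ᶜ := by
    intro y hy hyE
    obtain ⟨t, h1, h2, h3⟩ := hc y hyE
    exact h3 (hy t h1 h2)
  have hnull : μ {y : ℤ → G | ∀ t, a ≤ t → t < b → y t = x t} = 0 := by
    refine measure_mono_null hsub ?_
    exact (mem_ae_iff_prob_eq_one (measurableSet_TMC E)).2 hμ.2.2.1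
  rw [cylMass, measureReal_def, hnull] at h
  simp at h

lemma exists_extension_step {E : Set (G × G)} {μ : Measure (ℤ → G)} (hμ : GoodMeasure E μ)
    {x : ℤ → G} (hx : x ∈ TMC E) {a t : ℤ} (hat : a < t) {α β : ℝ}
    (h : α * cylMass μ x a (t + 1) ≤ β * cylMass μ x a t) :
    ∃ y ∈ TMC E, (∀ u, a ≤ u → u ≤ t → y u = x u) ∧
      α * cylMass μ y (a - 1) (t + 1) ≤ β * cylMass μ y (a - 1) t := by
  classical
  have := hμ.1
  set S := Finset.univ.filter fun c => 0 < cylMass μ (Function.update x (a - 1) c) (a - 1) t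
    with hS
  have hzero : ∀ c, c ∉ S → cylMass μ (Function.update x (a - 1) c) (a - 1) t = 0 := by
    intro c hc
    simp only [hS, Finset.mem_filter, Finset.mem_univ, true_and, not_lt] at hc
    exact le_antisymm hc (cylMass_nonneg _ _ _ _)
  have e1 : cylMass μ x a t = ∑ c ∈ S, cylMass μ (Function.update x (a - 1) c) (a - 1) t := by
    rw [cylMass_eq_sum_left μ x hat.le]
    exact (Finset.sum_subset (Finset.subset_univ _) fun c _ hc => hzero c hc).symm
  have e2 : cylMass μ x a (t + 1)
      = ∑ c ∈ S, cylMass μ (Function.update x (a - 1) c) (a - 1) (t + 1) := by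
    rw [cylMass_eq_sum_left μ x (by omega)]
    refine (Finset.sum_subset (Finset.subset_univ _) fun c _ hc => le_antisymm ?_
      (cylMass_nonneg _ _ _ _)).symm
    rw [← hzero c hc]
    exact cylMass_anti _ _ (by omega)
  have hne : S.Nonempty := by
    rw [Finset.nonempty_iff_ne_empty]
    intro h0
    have := cylMass_pos hμ hx a t
    rw [e1, h0, Finset.sum_empty] at this
    exact lt_irrefl _ this
  rw [e1, e2, Finset.mul_sum, Finset.mul_sum] at h
  obtain ⟨c, hc, hle⟩ := Finset.exists_le_of_sum_le hne h
  obtain ⟨z, hz, hzx⟩ := exists_point_of_cylMass_pos hμ (Finset.mem_filter.1 hc).2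
  have hzt : z (t - 1) = x (t - 1) := by
    rw [hzx _ (by omega) (by omega), Function.update_of_ne (by omega)]
  have hy := TMC_splice hz hx (t - 1) (t - 1) (by rw [hzt]; exact hx _)
  have hyu : ∀ u, a - 1 ≤ u → u ≤ t →
      (if u ≤ t - 1 then z u else x (u - (t - 1) + (t - 1))) = Function.update x (a - 1) c u := by
    intro u h1 h2
    split_ifs with h3
    · exact hzx u h1 (by omega)
    · rw [sub_add_cancel, Function.update_of_ne (by omega)]
  refine ⟨_, hy, fun u h1 h2 => ?_, ?_⟩
  · rw [hyu u (by omega) h2, Function.update_of_ne (by omega)]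
  · rw [cylMass_congr μ (fun u h1 h2 => hyu u h1 (by omega)),
      cylMass_congr μ (fun u h1 h2 => hyu u h1 (by omega))]
    exact hle

/-- A bound on a conditional probability given a finite word persists along some infinite past
extending that word. -/
lemma exists_extension {E : Set (G × G)} {μ : Measure (ℤ → G)} (hμ : GoodMeasure E μ)
    {x : ℤ → G} (hx : x ∈ TMC E) {a t : ℤ} (hat : a < t) {α β : ℝ}
    (h : α * cylMass μ x a (t + 1) ≤ β * cylMass μ x a t) :
    ∃ y ∈ TMC E, (∀ u, a ≤ u → y u = x u) ∧
      ∀ k : ℕ, α * cylMass μ y (a - k) (t + 1) ≤ β * cylMass μ y (a - k) t := by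
  have hstep : ∀ (k : ℕ) (x : ℤ → G), ∃ y, (x ∈ TMC E ∧
      α * cylMass μ x (a - k) (t + 1) ≤ β * cylMass μ x (a - k) t) →
      (y ∈ TMC E ∧ α * cylMass μ y (a - (k + 1 : ℕ)) (t + 1) ≤
        β * cylMass μ y (a - (k + 1 : ℕ)) t) ∧ ∀ u, a - k ≤ u → u ≤ t → y u = x u := by
    intro k x
    by_cases hk : x ∈ TMC E ∧ α * cylMass μ x (a - k) (t + 1) ≤ β * cylMass μ x (a - k) t
    · obtain ⟨y, hy, h1, h2⟩ := exists_extension_step hμ hk.1 (by omega) hk.2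
      refine ⟨y, fun _ => ⟨⟨hy, ?_⟩, h1⟩⟩
      rwa [show a - ((k + 1 : ℕ) : ℤ) = a - k - 1 by push_cast; ring]
    · exact ⟨x, fun h => absurd h hk⟩
  choose f hf using hstep
  set y : ℕ → ℤ → G := fun n => Nat.rec x (fun k z => f k z) n with hy
  have hy1 : ∀ k : ℕ, y k ∈ TMC E ∧
      α * cylMass μ (y k) (a - k) (t + 1) ≤ β * cylMass μ (y k) (a - k) t := by
    intro k
    induction k with
    | zero => exact ⟨hx, by simpa [hy] using h⟩
    | succ k ih => exact (hf k (y k) ih).1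
  have hy2 : ∀ k n : ℕ, ∀ u, a - k ≤ u → u ≤ t → y (k + n) u = y k u := by
    intro k n
    induction n with
    | zero => exact fun _ _ _ => rfl
    | succ n ih =>
      intro u h1 h2
      rw [← ih u h1 h2]
      exact (hf (k + n) (y (k + n)) (hy1 _)).2 u (by push_cast; omega) h2
  set z : ℤ → G := fun u => if a ≤ u then x u else y (a - u).toNat u with hz
  have hzy : ∀ k : ℕ, ∀ u, a - k ≤ u → u ≤ t → z u = y k u := by
    intro k u h1 h2
    simp only [hz]
    split_ifs with h3
    · have := hy2 0 k u (by simpa using h3) h2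
      rw [zero_add] at this
      exact this.symm
    · obtain ⟨n, hn⟩ : ∃ n, k = (a - u).toNat + n := ⟨k - (a - u).toNat, by omega⟩
      rw [hn]
      exact (hy2 _ n u (by omega) h2).symm
  refine ⟨z, fun u => ?_, fun u hu => if_pos hu, fun k => ?_⟩
  · rcases lt_or_ge u a with hu | hu
    · rw [hzy (a - u).toNat u (by omega) (by omega), hzy (a - u).toNat (u + 1) (by omega) (by omega)]
      exact (hy1 _).1 u
    · simp only [hz, if_pos hu, if_pos (show a ≤ u + 1 by omega)]
      exact hx u
  · rw [cylMass_congr μ (fun u h1 h2 => hzy k u h1 (by omega)),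
      cylMass_congr μ (fun u h1 h2 => hzy k u h1 (by omega))]
    exact (hy1 k).2

omit [Fintype G] in
lemma tendsto_cylMass_ratio {E : Set (G × G)} {μ : Measure (ℤ → G)} (hμ : GoodMeasure E μ)
    {ν : (ℕ → G) → G → ℝ}
    (hν : ∀ p, IsPast E p → ∀ a, (p 0, a) ∈ E → 0 < ν p a ∧
      Tendsto (fun m : ℕ =>
          (μ (cyl (Fin.snoc (pastWord p m) a))).toReal / (μ (cyl (pastWord p m))).toReal)
        atTop (nhds (ν p a))) {x : ℤ → G} (hx : x ∈ TMC E) (t : ℤ) :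
    IsPast E (fun i => x (t - 1 - i)) ∧ 0 < ν (fun i => x (t - 1 - i)) (x t) ∧
    Tendsto (fun m : ℕ => cylMass μ x (t - m) (t + 1) / cylMass μ x (t - m) t) atTop
      (𝓝 (ν (fun i => x (t - 1 - i)) (x t))) := by
  have hp : IsPast E (fun i : ℕ => x (t - 1 - i)) := by
    intro i
    have := hx (t - 1 - (i + 1 : ℕ))
    rwa [show t - 1 - ((i + 1 : ℕ) : ℤ) + 1 = t - 1 - i by push_cast; ring] at this
  have h0 : (x (t - 1 - (0 : ℕ)), x t) ∈ E := by
    have := hx (t - 1)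
    rw [sub_add_cancel] at this
    simpa using this
  obtain ⟨h1, h2⟩ := hν _ hp (x t) h0
  refine ⟨hp, h1, h2.congr fun m => ?_⟩
  have hw : ∀ i : Fin m, pastWord (fun i : ℕ => x (t - 1 - i)) m i = x (t - m + ((i : ℕ) : ℤ)) := by
    intro i
    have := i.2
    simp only [pastWord]
    congr 1
    omega
  rw [cyl_mass_eq hμ.2.1 x (t - m) _ hw, sub_add_cancel]
  congr 1
  rw [cyl_mass_eq hμ.2.1 x (t - m)]
  · congr 1
    push_cast
    ring
  · intro i
    refine Fin.lastCases ?_ (fun i => ?_) i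
    · simp
    · rw [Fin.snoc_castSucc, hw]
      rfl

lemma exists_conditional_bound {E : Set (G × G)} {μ : Measure (ℤ → G)} (hμ : GoodMeasure E μ)
    (hc : CCSD E μ) : ∃ g : ℕ → ℝ, (∀ m, 0 ≤ g m) ∧ Summable g ∧
      ∀ x ∈ TMC E, ∀ x' ∈ TMC E, ∀ (t : ℤ) (m : ℕ) (a : ℤ), 1 ≤ m → a ≤ t - m →
        (∀ u, t - m ≤ u → u ≤ t → x u = x' u) →
        cylMass μ x a (t + 1) * cylMass μ x' a t
          ≤ (1 + g m) * (cylMass μ x' a (t + 1) * cylMass μ x a t) := by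
  obtain ⟨ν, hν, γ, hγ, hdec⟩ := hc
  refine ⟨fun m => |γ m|, fun m => abs_nonneg _, hγ.abs, fun x hx x' hx' t m a hm ha hxx => ?_⟩
  set k := cylMass μ x a (t + 1) / cylMass μ x a t with hk
  set k' := cylMass μ x' a (t + 1) / cylMass μ x' a t with hk'
  have p1 := cylMass_pos hμ hx a t
  have p2 := cylMass_pos hμ hx' a t
  have lim : ∀ {x : ℤ → G} (_ : x ∈ TMC E) {α β : ℝ},
      α * cylMass μ x a (t + 1) ≤ β * cylMass μ x a t →
      ∃ y ∈ TMC E, (∀ u, a ≤ u → y u = x u) ∧ α * ν (fun i => y (t - 1 - i)) (y t) ≤ β := by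
    intro x hx α β h
    obtain ⟨y, hy, h1, h2⟩ := exists_extension hμ hx (by omega) h
    refine ⟨y, hy, h1, ?_⟩
    refine le_of_tendsto ((tendsto_cylMass_ratio hμ hν hy t).2.2.const_mul α) ?_
    filter_upwards [eventually_ge_atTop (t - a).toNat] with n hn
    have h3 := h2 (n - (t - a).toNat)
    rw [show a - ((n - (t - a).toNat : ℕ) : ℤ) = t - n by omega] at h3
    rw [← mul_div_assoc, div_le_iff₀ (cylMass_pos hμ hy _ _)]
    exact h3
  obtain ⟨y, hy, hyx, hyk⟩ := lim hx (α := -1) (β := -k) (by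
    rw [neg_mul, neg_mul, one_mul, hk, div_mul_cancel₀ _ p1.ne'])
  obtain ⟨y', hy', hyx', hyk'⟩ := lim hx' (α := 1) (β := k') (by
    rw [one_mul, hk', div_mul_cancel₀ _ p2.ne'])
  have hyt : y' t = y t := by rw [hyx' t (by omega), hyx t (by omega), hxx t (by omega) le_rfl]
  obtain ⟨q1, -, -⟩ := tendsto_cylMass_ratio hμ hν hy t
  obtain ⟨q2, pos2, -⟩ := tendsto_cylMass_ratio hμ hν hy' t
  have h0 : (y (t - 1 - (0 : ℕ)), y t) ∈ E := by
    have := hy (t - 1)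
    rw [sub_add_cancel] at this
    simpa using this
  have hd := hdec m hm _ _ q1 q2 (fun i hi => by
    rw [hyx _ (by omega), hyx' _ (by omega), hxx _ (by omega) (by omega)]) (y t) h0
  rw [hyt] at hyk' pos2
  have h1 := (le_abs_self _).trans (hd.trans (le_abs_self (γ m)))
  rw [sub_le_iff_le_add, div_le_iff₀ pos2] at h1
  have h2 : k ≤ (1 + |γ m|) * k' := by
    have : (1 + |γ m|) * ν (fun i => y' (t - 1 - i)) (y t) ≤ (1 + |γ m|) * k' := by
      have := abs_nonneg (γ m)
      gcongr
      linarith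
    linarith
  rw [hk, hk', div_le_iff₀ p1] at h2
  calc cylMass μ x a (t + 1) * cylMass μ x' a t
      ≤ (1 + |γ m|) * (cylMass μ x' a (t + 1) / cylMass μ x' a t) * cylMass μ x a t
          * cylMass μ x' a t := by gcongr
    _ = _ := by field_simp

/-- Conditional probabilities of allowed letters are bounded below. -/
lemma exists_conditional_lower_bound {E : Set (G × G)} {μ : Measure (ℤ → G)}
    (hμ : GoodMeasure E μ) (hc : CCSD E μ) : ∃ δ : ℝ, 0 < δ ∧ ∀ x ∈ TMC E, ∀ a t : ℤ, a < t →
      δ * cylMass μ x a t ≤ cylMass μ x a (t + 1) := by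
  have := hμ.1
  obtain ⟨g, hg0, -, hg⟩ := exists_conditional_bound hμ hc
  obtain ⟨δ, hδ, hδp⟩ : ∃ δ : ℝ, 0 < δ ∧ ∀ p : G × G,
      0 < (μ (cyl ![p.1, p.2])).toReal → δ ≤ (μ (cyl ![p.1, p.2])).toReal := by
    rcases (Finset.univ.filter fun p : G × G =>
      0 < (μ (cyl ![p.1, p.2])).toReal).eq_empty_or_nonempty with h | h
    · exact ⟨1, one_pos, fun p hp => absurd hp (Finset.filter_eq_empty_iff.1 h (Finset.mem_univ p))⟩
    · obtain ⟨p, hp, hmin⟩ := Finset.exists_min_image _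
        (fun p : G × G => (μ (cyl ![p.1, p.2])).toReal) h
      exact ⟨_, (Finset.mem_filter.1 hp).2, fun q hq =>
        hmin q (Finset.mem_filter.2 ⟨Finset.mem_univ q, hq⟩)⟩
  have hg1 := hg0 1
  refine ⟨δ / (1 + g 1), by positivity, fun x hx a t hat => ?_⟩
  have hpair : (μ (cyl ![x (t - 1), x t])).toReal = cylMass μ x (t - 1) (t + 1) := by
    rw [cyl_mass_eq hμ.2.1 x (t - 1)]
    · congr 1
      push_cast
      ring
    · intro i
      fin_cases i <;> simp
  have hlow : δ ≤ cylMass μ x (t - 1) (t + 1) := by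
    rw [← hpair]
    refine hδp (x (t - 1), x t) ?_
    simp only
    rw [hpair]
    exact cylMass_pos hμ hx _ _
  have hle1 : cylMass μ x (t - 1) t ≤ 1 := measureReal_le_one
  obtain ⟨y, hy, hyx, hyk⟩ := exists_extension (t := t) hμ hx (sub_one_lt t) (α := -1) (β := -δ)
    (by nlinarith)
  have h1 := hyk (t - 1 - a).toNat
  rw [show t - 1 - ((t - 1 - a).toNat : ℤ) = a by omega] at h1
  have h2 := hg y hy x hx t 1 a le_rfl (by push_cast; omega)
    (fun u h1 _ => hyx u (by push_cast at h1; omega))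
  have p1 := cylMass_pos hμ hy a t
  have p2 := cylMass_pos hμ hx a t
  rw [div_mul_eq_mul_div, div_le_iff₀ (by positivity)]
  have h3 : δ * cylMass μ y a t * cylMass μ x a t
      ≤ (1 + g 1) * (cylMass μ x a (t + 1) * cylMass μ y a t) :=
    le_trans (by nlinarith) h2
  refine le_of_mul_le_mul_right ?_ p1
  linarith

/-- How the cylinder masses of two points differing only on a bounded window compare. -/
lemma exists_window_bounds {E : Set (G × G)} {μ : Measure (ℤ → G)} (hμ : GoodMeasure E μ)
    (hc : CCSD E μ) (s : ℕ) : ∃ (C : ℝ) (Γ : ℕ → ℝ), 1 ≤ C ∧ (∀ l, 0 ≤ Γ l) ∧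
      Tendsto Γ atTop (𝓝 0) ∧
      ∀ x ∈ TMC E, ∀ x' ∈ TMC E, ∀ a i : ℤ, a < i → (∀ u, u < i ∨ i + s ≤ u → x u = x' u) →
        (∀ b, i + s + 1 ≤ b → cylMass μ x' a b ≤ C * cylMass μ x a b) ∧
        ∀ (l : ℕ) (c : ℤ), 1 ≤ l → i + s + l ≤ c →
          cylMass μ x' a c * cylMass μ x a (i + s + l)
            ≤ Real.exp (Γ l) * (cylMass μ x a c * cylMass μ x' a (i + s + l)) := by
  have := hμ.1
  obtain ⟨g, hg0, hgs, hg⟩ := exists_conditional_bound hμ hc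
  obtain ⟨δ, hδ, hlow⟩ := exists_conditional_lower_bound hμ hc
  have hsumm : ∀ l, Summable fun j => g (j + l) := fun l => (summable_nat_add_iff l).2 hgs
  have main : ∀ x ∈ TMC E, ∀ x' ∈ TMC E, ∀ a i : ℤ, a < i →
      (∀ u, u < i ∨ i + s ≤ u → x u = x' u) →
        ∀ (l : ℕ) (c : ℤ), 1 ≤ l → i + s + l ≤ c →
          cylMass μ x' a c * cylMass μ x a (i + s + l)
            ≤ Real.exp (∑' j, g (j + l)) * (cylMass μ x a c * cylMass μ x' a (i + s + l)) := by
    intro x hx x' hx' a i hai hxx l c hl hlc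
    have key : ∀ n : ℕ, cylMass μ x' a (i + s + l + n) * cylMass μ x a (i + s + l)
        ≤ Real.exp (∑ j ∈ Finset.range n, g (j + l)) *
          (cylMass μ x a (i + s + l + n) * cylMass μ x' a (i + s + l)) := by
      intro n
      induction n with
      | zero => simp [mul_comm]
      | succ n ih =>
        have h1 := hg x' hx' x hx (i + s + l + n) (n + l) a (by omega) (by push_cast; omega)
          (fun u h1 _ => (hxx u (Or.inr (by push_cast at h1; omega))).symm)
        rw [show i + s + l + ((n + 1 : ℕ) : ℤ) = i + s + l + n + 1 by push_cast; ring,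
          Finset.sum_range_succ, Real.exp_add]
        have p1 := cylMass_pos hμ hx a (i + s + l + n)
        have p2 := cylMass_pos hμ hx' a (i + s + l + n)
        have p3 := cylMass_pos hμ hx a (i + s + l)
        have p4 := cylMass_pos hμ hx' a (i + s + l)
        have p5 := cylMass_pos hμ hx a (i + s + l + n + 1)
        have he : 1 + g (n + l) ≤ Real.exp (g (n + l)) := by
          rw [add_comm]; exact Real.add_one_le_exp _
        refine le_of_mul_le_mul_right ?_ p1
        calc cylMass μ x' a (i + s + l + n + 1) * cylMass μ x a (i + s + l)
              * cylMass μ x a (i + s + l + n)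
            = cylMass μ x' a (i + s + l + n + 1) * cylMass μ x a (i + s + l + n)
              * cylMass μ x a (i + s + l) := by ring
          _ ≤ (1 + g (n + l)) * (cylMass μ x a (i + s + l + n + 1) * cylMass μ x' a (i + s + l + n))
              * cylMass μ x a (i + s + l) := by gcongr
          _ ≤ Real.exp (g (n + l)) *
              (cylMass μ x a (i + s + l + n + 1) * cylMass μ x' a (i + s + l + n))
              * cylMass μ x a (i + s + l) := by gcongr
          _ = Real.exp (g (n + l)) * cylMass μ x a (i + s + l + n + 1) *
              (cylMass μ x' a (i + s + l + n) * cylMass μ x a (i + s + l)) := by ring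
          _ ≤ Real.exp (g (n + l)) * cylMass μ x a (i + s + l + n + 1) *
              (Real.exp (∑ j ∈ Finset.range n, g (j + l)) *
                (cylMass μ x a (i + s + l + n) * cylMass μ x' a (i + s + l))) := by gcongr
          _ = _ := by ring
    have h2 := key (c - (i + s + l)).toNat
    rw [show i + s + l + ((c - (i + s + l)).toNat : ℤ) = c by omega] at h2
    refine h2.trans ?_
    have p4 := cylMass_nonneg μ x' a (i + s + l)
    have p5 := cylMass_nonneg μ x a c
    gcongr
    exact (hsumm l).sum_le_tsum _ fun j _ => hg0 _
  have hle : ∀ x ∈ TMC E, ∀ a i : ℤ, a < i → ∀ n : ℕ,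
      δ ^ n * cylMass μ x a i ≤ cylMass μ x a (i + n) := by
    intro x hx a i hai n
    induction n with
    | zero => simp
    | succ n ih =>
      have := hlow x hx a (i + n) (by omega)
      rw [show i + ((n + 1 : ℕ) : ℤ) = i + n + 1 by push_cast; ring, pow_succ', mul_assoc]
      refine le_trans ?_ this
      gcongr
  refine ⟨max 1 (Real.exp (∑' j, g (j + 1)) * (δ ^ (s + 1))⁻¹), fun l => ∑' j, g (j + l),
    le_max_left _ _, fun l => tsum_nonneg fun j => hg0 _, tendsto_sum_nat_add g,
    fun x hx x' hx' a i hai hxx => ⟨fun b hb => ?_, main x hx x' hx' a i hai hxx⟩⟩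
  have h1 := main x hx x' hx' a i hai hxx 1 b le_rfl (by push_cast; omega)
  have p0 := cylMass_pos hμ hx a (i + s + (1 : ℕ))
  have h2 : cylMass μ x' a (i + s + (1 : ℕ)) ≤ (δ ^ (s + 1))⁻¹ * cylMass μ x a (i + s + (1 : ℕ)) := by
    rw [← div_eq_inv_mul, le_div_iff₀ (by positivity), mul_comm]
    have h3 := hle x hx a i hai (s + 1)
    rw [show i + ((s + 1 : ℕ) : ℤ) = i + s + (1 : ℕ) by push_cast; ring] at h3
    refine le_trans ?_ h3
    gcongr
    rw [cylMass_congr μ (fun u _ h2 => hxx u (Or.inl h2))]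
    exact cylMass_anti μ x' (by omega)
  have p5 := cylMass_nonneg μ x a b
  refine le_trans ?_ (mul_le_mul_of_nonneg_right (le_max_right _ _) p5)
  refine le_of_mul_le_mul_right (h1.trans ?_) p0
  calc _ ≤ Real.exp (∑' j, g (j + 1)) * (cylMass μ x a b *
        ((δ ^ (s + 1))⁻¹ * cylMass μ x a (i + s + (1 : ℕ)))) := by gcongr
    _ = _ := by ring

end CompleteConnections

section Decoupling

/-- The mean of `χ` with respect to the weights `p` along an orbit. -/
noncomputable def orbitMean {D W : Type*} [Fintype D] (p : W → ℝ) (T : D → W → W) (χ : D → ℂ)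
    (w : W) : ℂ := (∑ d, (p (T d w) : ℂ) * χ d) / ((∑ d, p (T d w) : ℝ) : ℂ)

lemma orbitMean_norm_le {D W : Type*} [Fintype D] [AddCommGroup D] {p : W → ℝ} {T : D → W → W}
    {χ : AddChar D ℂ} (hχ : χ ≠ 0) {C : ℝ} (hC : 1 ≤ C) {w : W} (hp : ∀ d, 0 < p (T d w))
    (h : ∀ d e, p (T d w) ≤ C * p (T e w)) : ‖orbitMean p T χ w‖ ≤ 1 - 1 / C := by
  set Z := ∑ d, p (T d w) with hZ
  have hZpos : 0 < Z := Finset.sum_pos (fun d _ => hp d) Finset.univ_nonempty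
  set n : ℝ := (Fintype.card D : ℝ) with hn
  have hnpos : 0 < n := by rw [hn]; exact_mod_cast Fintype.card_pos
  have hlow : ∀ d, Z / (C * n) ≤ p (T d w) := by
    intro d
    rw [div_le_iff₀ (by positivity)]
    calc Z ≤ ∑ _e : D, C * p (T d w) := Finset.sum_le_sum fun e _ => h e d
      _ = _ := by rw [Finset.sum_const, Finset.card_univ, nsmul_eq_mul]; ring
  have hsum0 : ∑ d, χ d = 0 := AddChar.sum_eq_zero_iff_ne_zero.2 hχ
  have e1 : ∑ d, (p (T d w) : ℂ) * χ d = ∑ d, ((p (T d w) - Z / (C * n) : ℝ) : ℂ) * χ d := by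
    simp only [Complex.ofReal_sub, sub_mul, Finset.sum_sub_distrib, ← Finset.mul_sum, hsum0,
      mul_zero, sub_zero]
  rw [orbitMean, e1, ← hZ, norm_div, Complex.norm_real, Real.norm_of_nonneg hZpos.le,
    div_le_iff₀ hZpos]
  calc ‖∑ d, ((p (T d w) - Z / (C * n) : ℝ) : ℂ) * χ d‖
      ≤ ∑ d, (p (T d w) - Z / (C * n)) := by
        refine norm_sum_le_of_le _ fun d _ => ?_
        rw [norm_mul, Complex.norm_real, AddChar.norm_apply, mul_one,
          Real.norm_of_nonneg (sub_nonneg.2 (hlow d))]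
    _ = (1 - 1 / C) * Z := by
        rw [Finset.sum_sub_distrib, ← hZ, Finset.sum_const, Finset.card_univ, nsmul_eq_mul, ← hn]
        have : C ≠ 0 := by positivity
        field_simp

lemma orbitMean_sub_norm_le {D W : Type*} [Fintype D] [AddCommGroup D] {p p' : W → ℝ}
    {T : D → W → W} (χ : AddChar D ℂ) {κ : ℝ} (hκ : 0 ≤ κ) {w : W} (hp : ∀ d, 0 < p (T d w))
    (hp' : ∀ d, 0 < p' (T d w))
    (h : ∀ d e, p (T d w) * p' (T e w) ≤ (1 + κ) * (p (T e w) * p' (T d w))) :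
    ‖orbitMean p T χ w - orbitMean p' T χ w‖ ≤ 2 * κ := by
  set Z := ∑ d, p (T d w) with hZ
  set Z' := ∑ d, p' (T d w) with hZ'
  have hZpos : 0 < Z := Finset.sum_pos (fun d _ => hp d) Finset.univ_nonempty
  have hZpos' : 0 < Z' := Finset.sum_pos (fun d _ => hp' d) Finset.univ_nonempty
  have h1 : ∀ d, p (T d w) / Z ≤ (1 + κ) * (p' (T d w) / Z') := by
    intro d
    rw [← mul_div_assoc, div_le_div_iff₀ hZpos hZpos', hZ, hZ', Finset.mul_sum, Finset.mul_sum]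
    exact Finset.sum_le_sum fun e _ => by linarith [h d e]
  have h2 : ∀ d, p' (T d w) / Z' ≤ (1 + κ) * (p (T d w) / Z) := by
    intro d
    rw [← mul_div_assoc, div_le_div_iff₀ hZpos' hZpos, hZ, hZ', Finset.mul_sum, Finset.mul_sum]
    exact Finset.sum_le_sum fun e _ => by linarith [h e d]
  have e1 : orbitMean p T χ w - orbitMean p' T χ w
      = ∑ d, ((p (T d w) / Z - p' (T d w) / Z' : ℝ) : ℂ) * χ d := by
    rw [orbitMean, orbitMean, ← hZ, ← hZ', Finset.sum_div, Finset.sum_div,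
      ← Finset.sum_sub_distrib]
    refine Finset.sum_congr rfl fun d _ => ?_
    push_cast
    ring
  rw [e1]
  calc _ ≤ ∑ d, κ * (p (T d w) / Z + p' (T d w) / Z') := by
        refine norm_sum_le_of_le _ fun d _ => ?_
        rw [norm_mul, Complex.norm_real, AddChar.norm_apply, mul_one, Real.norm_eq_abs, abs_le]
        have q1 : 0 < p (T d w) / Z := div_pos (hp d) hZpos
        have q2 : 0 < p' (T d w) / Z' := div_pos (hp' d) hZpos'
        constructor <;> nlinarith [h1 d, h2 d]
    _ = 2 * κ := by
        rw [← Finset.mul_sum, Finset.sum_add_distrib, ← Finset.sum_div, ← Finset.sum_div, ← hZ,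
          ← hZ', div_self hZpos.ne', div_self hZpos'.ne']
        ring

lemma sum_mul_orbitMean {D W : Type*} [Fintype D] [AddCommGroup D] [Fintype W] {m : W → ℝ}
    (hm : ∀ w, 0 ≤ m w) {T : D → W → W} (hT0 : ∀ w, T 0 w = w)
    (hTadd : ∀ d e w, T (d + e) w = T d (T e w)) (χ : AddChar D ℂ) {F r : W → ℂ}
    (hF : ∀ d w, F (T d w) = χ d * F w) (hr : ∀ d w, r (T d w) = r w) :
    ∑ w, (m w : ℂ) * F w * r w = ∑ w, (m w : ℂ) * F w * (r w * orbitMean m T χ w) := by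
  set Z : W → ℝ := fun w => ∑ d, m (T d w) with hZ
  have hZT : ∀ e w, Z (T e w) = Z w := by
    intro e w
    simp only [hZ, ← hTadd]
    exact Fintype.sum_equiv (Equiv.addRight e) _ _ fun d => rfl
  have hinv : ∀ d w, T (-d) (T d w) = w := fun d w => by rw [← hTadd, neg_add_cancel, hT0]
  have hinv' : ∀ d w, T d (T (-d) w) = w := fun d w => by rw [← hTadd, add_neg_cancel, hT0]
  have hsumneg : ∀ w, ∑ d, m (T (-d) w) = Z w := fun w =>
    Fintype.sum_equiv (Equiv.neg D) _ _ fun d => rfl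
  have hZ0 : ∀ w, m w ≠ 0 → (Z w : ℂ) ≠ 0 := by
    intro w hw
    rw [Complex.ofReal_ne_zero]
    refine (lt_of_lt_of_le (lt_of_le_of_ne (hm w) hw.symm) ?_).ne'
    have := Finset.single_le_sum (f := fun d => m (T d w)) (fun d _ => hm _) (Finset.mem_univ 0)
    simpa only [hT0] using this
  calc ∑ w, (m w : ℂ) * F w * r w
      = ∑ w, ∑ d, (m w : ℂ) * F w * r w * (m (T (-d) w) / Z w) := by
        refine Finset.sum_congr rfl fun w _ => ?_
        rw [← Finset.mul_sum, ← Finset.sum_div]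
        by_cases hw : m w = 0
        · simp [hw]
        · rw [← Complex.ofReal_sum, hsumneg, div_self (hZ0 w hw), mul_one]
    _ = ∑ d, ∑ w, (m w : ℂ) * F w * r w * (m (T (-d) w) / Z w) := Finset.sum_comm
    _ = ∑ d, ∑ w, (m w : ℂ) * F w * (r w * (m (T d w) * χ d / Z w)) := by
        refine Finset.sum_congr rfl fun d _ => ?_
        refine Fintype.sum_equiv ⟨T (-d), T d, hinv' d, hinv d⟩ _ _ fun w => ?_
        simp only [Equiv.coe_fn_mk]
        obtain ⟨v, rfl⟩ : ∃ v, w = T d v := ⟨_, (hinv' d w).symm⟩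
        rw [hinv, hF, hr, hZT]
        ring
    _ = _ := by
        rw [Finset.sum_comm]
        refine Finset.sum_congr rfl fun w _ => ?_
        rw [orbitMean, ← Finset.mul_sum, ← Finset.mul_sum, ← Finset.sum_div]

/-- Iterated decoupling: a function transforming under nontrivial characters of several
sufficiently independent local symmetries of a weight has small weighted sum. -/
lemma norm_sum_le_of_decoupling {D W : Type*} [Fintype D] [AddCommGroup D] [Fintype W] {m : W → ℝ}
    (hm : ∀ w, 0 ≤ m w) (hm1 : ∑ w, m w = 1) {T : ℤ → D → W → W} (hT0 : ∀ i w, T i 0 w = w)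
    (hTadd : ∀ i d e w, T i (d + e) w = T i d (T i e w)) (χ : ℤ → AddChar D ℂ) {F : W → ℂ}
    (hF1 : ∀ w, ‖F w‖ ≤ 1) {P : ℤ → W → ℝ} {C κ : ℝ} (hC : 1 ≤ C) (hκ : 0 ≤ κ) (S : Finset ℤ)
    (hmT : ∀ i ∈ S, ∀ d w, 0 < m w → 0 < m (T i d w))
    (hF : ∀ i ∈ S, ∀ d w, F (T i d w) = χ i d * F w) (hχ : ∀ i ∈ S, χ i ≠ 0)
    (hPpos : ∀ i ∈ S, ∀ w, 0 < m w → 0 < P i w)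
    (hPinv : ∀ i ∈ S, ∀ j ∈ S, i < j → ∀ d e w, P i (T i d (T j e w)) = P i (T i d w))
    (hPC : ∀ i ∈ S, ∀ d w, 0 < m w → P i (T i d w) ≤ C * P i w)
    (hPκ : ∀ i ∈ S, ∀ d w, 0 < m w → m (T i d w) * P i w ≤ (1 + κ) * (m w * P i (T i d w))) :
    ‖∑ w, (m w : ℂ) * F w‖ ≤ (1 - 1 / C) ^ S.card + 2 * κ * C := by
  have hC0 : 0 < C := by linarith
  have hδ : 0 ≤ 1 - 1 / C := by
    rw [sub_nonneg, div_le_one hC0]; exact hC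
  have key : ∀ (r : W → ℂ) (c : ℝ), 0 ≤ c → (∀ w, 0 < m w → ‖r w‖ ≤ c) →
      (∀ i ∈ S, ∀ d w, r (T i d w) = r w) →
      ‖∑ w, (m w : ℂ) * F w * r w‖ ≤ c * ((1 - 1 / C) ^ S.card + 2 * κ * C) := by
    induction S using Finset.induction_on_min with
    | empty =>
      intro r c hc hrc _
      calc _ ≤ ∑ w, m w * c := by
            refine norm_sum_le_of_le _ fun w _ => ?_
            rw [norm_mul, norm_mul, Complex.norm_real, Real.norm_of_nonneg (hm w)]
            rcases (hm w).eq_or_lt with h | h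
            · simp [← h]
            · calc m w * ‖F w‖ * ‖r w‖ ≤ m w * 1 * c := by
                    gcongr
                    · exact hF1 w
                    · exact hrc w h
                _ = _ := by ring
        _ = c := by rw [← Finset.sum_mul, hm1, one_mul]
        _ ≤ _ := by
            rw [Finset.card_empty, pow_zero]
            have : 0 ≤ 2 * κ * C := by positivity
            nlinarith
    | insert i S hiS ih =>
      intro r c hc hrc hr
      have hi := Finset.mem_insert_self i S
      have hS : ∀ {j}, j ∈ S → j ∈ insert i S := fun h => Finset.mem_insert_of_mem h
      have hniS : i ∉ S := fun h => lt_irrefl i (hiS i h)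
      have hcross : ∀ w, 0 < m w → ∀ d e,
          P i (T i d w) ≤ C * P i (T i e w) ∧
          m (T i d w) * P i (T i e w) ≤ (1 + κ) * (m (T i e w) * P i (T i d w)) := by
        intro w hw d e
        have h1 := hPC i hi (d - e) (T i e w) (hmT i hi e w hw)
        have h2 := hPκ i hi (d - e) (T i e w) (hmT i hi e w hw)
        rw [← hTadd, sub_add_cancel] at h1 h2
        exact ⟨h1, h2⟩
      have hmean1 : ∀ w, 0 < m w → ‖orbitMean (P i) (T i) (χ i) w‖ ≤ 1 - 1 / C := fun w hw =>
        orbitMean_norm_le (hχ i hi) hC (fun d => hPpos i hi _ (hmT i hi d w hw))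
          fun d e => (hcross w hw d e).1
      have hmean2 : ∀ w, 0 < m w →
          ‖orbitMean m (T i) (χ i) w - orbitMean (P i) (T i) (χ i) w‖ ≤ 2 * κ := fun w hw =>
        orbitMean_sub_norm_le (χ i) hκ (hmT i hi · w hw)
          (fun d => hPpos i hi _ (hmT i hi d w hw)) fun d e => (hcross w hw d e).2
      have hmain := ih (fun j hj => hmT j (hS hj)) (fun j hj => hF j (hS hj))
        (fun j hj => hχ j (hS hj)) (fun j hj => hPpos j (hS hj))
        (fun j hj k hk => hPinv j (hS hj) k (hS hk)) (fun j hj => hPC j (hS hj))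
        (fun j hj => hPκ j (hS hj)) (fun w => r w * orbitMean (P i) (T i) (χ i) w)
        (c * (1 - 1 / C)) (by positivity)
        (fun w hw => by
          rw [norm_mul]
          exact mul_le_mul (hrc w hw) (hmean1 w hw) (norm_nonneg _) hc)
        (fun j hj d w => by
          rw [hr j (hS hj)]
          congr 1
          simp only [orbitMean, hPinv i hi j (hS hj) (hiS j hj)])
      have herr : ‖∑ w, (m w : ℂ) * F w * (r w * orbitMean m (T i) (χ i) w)
          - ∑ w, (m w : ℂ) * F w * (r w * orbitMean (P i) (T i) (χ i) w)‖ ≤ c * (2 * κ) := by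
        rw [← Finset.sum_sub_distrib]
        calc _ ≤ ∑ w, m w * (c * (2 * κ)) := by
              refine norm_sum_le_of_le _ fun w _ => ?_
              rw [← mul_sub, ← mul_sub, norm_mul, norm_mul, norm_mul, Complex.norm_real,
                Real.norm_of_nonneg (hm w)]
              rcases (hm w).eq_or_lt with h | h
              · simp [← h]
              · calc m w * ‖F w‖ * (‖r w‖ * _) ≤ m w * 1 * (c * (2 * κ)) := by
                      gcongr
                      · exact hF1 w
                      · exact hrc w h
                      · exact hmean2 w h
                  _ = _ := by ring
          _ = _ := by rw [← Finset.sum_mul, hm1, one_mul]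
      rw [sum_mul_orbitMean hm (hT0 i) (hTadd i) (χ i) (hF i hi) (hr i hi)]
      have h3 := norm_le_norm_add_norm_sub' (∑ w, (m w : ℂ) * F w * (r w * orbitMean m (T i) (χ i) w))
        (∑ w, (m w : ℂ) * F w * (r w * orbitMean (P i) (T i) (χ i) w))
      rw [Finset.card_insert_of_notMem hniS, pow_succ]
      have h4 : c * (1 - 1 / C) * ((1 - 1 / C) ^ S.card + 2 * κ * C) + c * (2 * κ)
          = c * ((1 - 1 / C) ^ S.card * (1 - 1 / C) + 2 * κ * C) := by
        field_simp
        ring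
      linarith
  simpa using key (fun _ => 1) 1 zero_le_one (by simp) (by simp)

end Decoupling

section HarmonicMixing

variable {G : Type*} [Fintype G] [MeasurableSpace G] [MeasurableSingletonClass G]

open Classical in
/-- Extend a word on `[a, c)` to a bi-infinite sequence by a constant letter. -/
noncomputable def extendWord (g : G) {a c : ℤ} (w : Set.Ico a c → G) (t : ℤ) : G :=
  if h : t ∈ Set.Ico a c then w ⟨t, h⟩ else g

omit [Fintype G] [MeasurableSpace G] [MeasurableSingletonClass G] in
lemma extendWord_apply (g : G) {a c : ℤ} (w : Set.Ico a c → G) {t : ℤ} (h : t ∈ Set.Ico a c) :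
    extendWord g w t = w ⟨t, h⟩ := dif_pos h

open Classical in
lemma integral_eq_sum_cylMass (μ : Measure (ℤ → G)) [IsProbabilityMeasure μ] (g : G) {a c : ℤ}
    {F : (ℤ → G) → ℂ} (hF : ∀ x y, (∀ t, a ≤ t → t < c → x t = y t) → F x = F y) :
    ∫ x, F x ∂μ = ∑ w : Set.Ico a c → G, (cylMass μ (extendWord g w) a c : ℂ) *
      F (extendWord g w) := by
  have hπ : Measurable fun (x : ℤ → G) (t : Set.Ico a c) => x t :=
    measurable_pi_lambda _ fun t => measurable_pi_apply _
  have h1 : ∀ x, F x = F (extendWord g fun t : Set.Ico a c => x t) := fun x =>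
    hF _ _ fun t h1 h2 => by rw [extendWord_apply g _ ⟨h1, h2⟩]
  have : IsProbabilityMeasure (μ.map fun (x : ℤ → G) (t : Set.Ico a c) => x t) :=
    Measure.isProbabilityMeasure_map hπ.aemeasurable
  rw [integral_congr_ae (Eventually.of_forall h1),
    ← integral_map (f := fun w => F (extendWord g w)) hπ.aemeasurable
      (measurable_of_finite _).aestronglyMeasurable,
    integral_fintype (Integrable.of_finite)]
  refine Finset.sum_congr rfl fun w _ => ?_
  rw [Complex.real_smul, map_measureReal_apply hπ (measurableSet_singleton _), cylMass]
  congr 3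
  ext x
  simp only [Set.mem_preimage, Set.mem_singleton_iff, Set.mem_ofPred_eq]
  constructor
  · rintro rfl t h1 h2
    rw [extendWord_apply g _ ⟨h1, h2⟩]
  · intro h
    ext t
    rw [h t t.2.1 t.2.2, extendWord_apply g w t.2]

variable {K : Type*} [AddCommGroup K] [AddAction K G]

/-- Harmonic mixing: a local function transforming under nontrivial characters of translates of a
finite group of local symmetries has small integral if there are many such translates. -/
lemma exists_harmonic_mixing_bound {E : Set (G × G)} {μ : Measure (ℤ → G)} (hμ : GoodMeasure E μ)
    (hc : CCSD E μ) {s : ℕ} (D : AddSubgroup (ℤ → K)) [Finite D]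
    (hDs : ∀ d ∈ D, ∀ t, t < 0 ∨ (s : ℤ) ≤ t → d t = 0)
    (hDE : ∀ d ∈ D, ∀ i : ℤ, ∀ x ∈ TMC E, (fun t => d (t - i) +ᵥ x t) ∈ TMC E) {ε : ℝ}
    (hε : 0 < ε) :
    ∃ R : ℕ, ∀ (F : (ℤ → G) → ℂ) (q : ℕ),
      (∀ x y, (∀ t : ℤ, -q ≤ t → t < q → x t = y t) → F x = F y) → (∀ x, ‖F x‖ ≤ 1) →
      ∀ (S : Finset ℤ) (χ : ℤ → AddChar D ℂ), R ≤ S.card → (∀ i ∈ S, χ i ≠ 0) →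
        (∀ i ∈ S, ∀ (d : D) x, F (fun t => (d : ℤ → K) (t - i) +ᵥ x t) = χ i d * F x) →
        ‖∫ x, F x ∂μ‖ ≤ ε := by
  classical
  have := hμ.1
  have := Fintype.ofFinite D
  obtain ⟨C, Γ, hC, hΓ0, hΓ, hbound⟩ := exists_window_bounds hμ hc s
  have hC0 : 0 < C := by linarith
  obtain ⟨l, hl1, hl⟩ : ∃ l : ℕ, 1 ≤ l ∧ 2 * (Real.exp (Γ l) - 1) * C < ε / 2 := by
    have h1 : Tendsto (fun l => 2 * (Real.exp (Γ l) - 1) * C) atTop (𝓝 0) := by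
      have := (((Real.continuous_exp.tendsto 0).comp hΓ).sub_const 1).const_mul 2 |>.mul_const C
      simpa using this
    exact ((eventually_ge_atTop 1).and (h1.eventually (gt_mem_nhds (half_pos hε)))).exists
  obtain ⟨n, hn⟩ := exists_pow_lt_of_lt_one (half_pos hε)
    (show 1 - 1 / C < 1 by have := one_div_pos.2 hC0; linarith)
  refine ⟨(s + l) * n, fun F q hFq hF1 S χ hS hχ hFχ => ?_⟩
  obtain ⟨S', hS'S, hS'n, hS'⟩ : ∃ S' ⊆ S, n ≤ S'.card ∧
      ∀ i ∈ S', ∀ j ∈ S', i < j → i + s + l ≤ j := by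
    obtain ⟨y, -, hy⟩ := Finset.exists_le_card_fiber_of_mul_le_card_of_maps_to
      (s := S) (t := Finset.Ico (0 : ℤ) (s + l)) (f := fun i => i % (s + l)) (n := n)
      (fun i _ => Finset.mem_Ico.2 ⟨Int.emod_nonneg _ (by omega), Int.emod_lt_of_pos _ (by omega)⟩)
      ⟨0, Finset.mem_Ico.2 (by omega)⟩ (by
        rwa [Int.card_Ico, show ((s : ℤ) + l - 0).toNat = s + l by omega])
    refine ⟨_, Finset.filter_subset _ _, hy, fun i hi j hj hij => ?_⟩
    have h1 := (Finset.mem_filter.1 hi).2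
    have h2 := (Finset.mem_filter.1 hj).2
    obtain ⟨k, hk⟩ := Int.ModEq.dvd (show i ≡ j [ZMOD (s + l)] from h1.trans h2.symm)
    have hk0 : 0 < k := by
      by_contra hneg
      have : ((s : ℤ) + l) * k ≤ 0 := mul_nonpos_of_nonneg_of_nonpos (by omega) (by omega)
      omega
    nlinarith
  obtain ⟨a, c, haS, hcS, haq, hcq⟩ : ∃ a c : ℤ, (∀ i ∈ S', a < i) ∧ (∀ i ∈ S', i + s + l ≤ c) ∧
      a ≤ -q ∧ q ≤ c := by
    obtain ⟨a, ha⟩ := S'.bddBelow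
    obtain ⟨c, hc⟩ := S'.bddAbove
    refine ⟨min (a - 1) (-q), max (c + s + l) q, fun i hi => ?_, fun i hi => ?_,
      min_le_right _ _, le_max_right _ _⟩
    · exact (min_le_left _ _).trans_lt (by have := ha hi; omega)
    · exact le_trans (by have := hc hi; omega) (le_max_left _ _)
  have hFac : ∀ x y, (∀ t, a ≤ t → t < c → x t = y t) → F x = F y := fun x y h =>
    hFq x y fun t h1 h2 => h t (haq.trans h1) (h2.trans_le hcq)
  have hne : Nonempty (ℤ → G) := by
    have : NeZero μ := ⟨IsProbabilityMeasure.ne_zero μ⟩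
    exact μ.nonempty_of_neZero
  obtain ⟨x₀⟩ := hne
  set g := x₀ 0
  set T : ℤ → D → (Set.Ico a c → G) → Set.Ico a c → G :=
    fun i d w t => (d : ℤ → K) (t - i) +ᵥ w t with hT
  have hext : ∀ i (d : D) w t, a ≤ t → t < c →
      extendWord g (T i d w) t = (d : ℤ → K) (t - i) +ᵥ extendWord g w t := by
    intro i d w t h1 h2
    rw [extendWord_apply g _ ⟨h1, h2⟩, extendWord_apply g _ ⟨h1, h2⟩]
  have hpt : ∀ w, 0 < cylMass μ (extendWord g w) a c → ∀ (i : ℤ) (d : D), ∃ x ∈ TMC E, ∃ x' ∈ TMC E,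
      (∀ u, u < i ∨ i + s ≤ u → x u = x' u) ∧
      (∀ b, b ≤ c → cylMass μ (extendWord g w) a b = cylMass μ x a b) ∧
      ∀ b, b ≤ c → cylMass μ (extendWord g (T i d w)) a b = cylMass μ x' a b := by
    intro w hw i d
    obtain ⟨x, hx, hxw⟩ := exists_point_of_cylMass_pos hμ hw
    refine ⟨x, hx, _, hDE d d.2 i x hx, fun u hu => ?_, fun b hb => ?_, fun b hb => ?_⟩
    · rw [hDs d d.2 (u - i) (by omega), zero_vadd]
    · exact cylMass_congr μ fun t h1 h2 => (hxw t h1 (h2.trans_le hb)).symm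
    · refine cylMass_congr μ fun t h1 h2 => ?_
      rw [hext i d w t h1 (h2.trans_le hb), hxw t h1 (h2.trans_le hb)]
  have hsum := integral_eq_sum_cylMass μ g (F := fun _ => 1) (a := a) (c := c) fun _ _ _ => rfl
  have hsum1 : ∑ w : Set.Ico a c → G, cylMass μ (extendWord g w) a c = 1 := by
    simp only [integral_const, probReal_univ, one_smul, mul_one] at hsum
    exact_mod_cast hsum.symm
  rw [integral_eq_sum_cylMass μ g hFac]
  refine (norm_sum_le_of_decoupling (m := fun w => cylMass μ (extendWord g w) a c)
    (P := fun i w => cylMass μ (extendWord g w) a (i + s + l)) (T := T) (C := C)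
    (κ := Real.exp (Γ l) - 1) (fun w => cylMass_nonneg _ _ _ _) hsum1 ?_ ?_ χ
    (F := fun w => F (extendWord g w)) (fun w => hF1 _) hC ?_ S' ?_ ?_ ?_ ?_ ?_ ?_ ?_).trans ?_
  · intro i w
    ext t
    simp [hT]
  · intro i d e w
    ext t
    simp [hT, add_vadd]
  · exact sub_nonneg.2 (Real.one_le_exp (hΓ0 l))
  · intro i hi d w hw
    obtain ⟨x, hx, x', hx', -, -, h2⟩ := hpt w hw i d
    rw [h2 c le_rfl]
    exact cylMass_pos hμ hx' _ _
  · intro i hi d w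
    rw [← hFχ i (hS'S hi) d]
    exact hFac _ _ fun t h1 h2 => hext i d w t h1 h2
  · exact fun i hi => hχ i (hS'S hi)
  · intro i hi w hw
    exact hw.trans_le (cylMass_anti μ _ (hcS i hi))
  · intro i hi j hj hij d e w
    refine cylMass_congr μ fun t h1 h2 => ?_
    have htc : t < c := h2.trans_le (hcS i hi)
    rw [hext i d _ t h1 htc, hext i d _ t h1 htc, hext j e _ t h1 htc,
      hDs e e.2 (t - j) (Or.inl (by have := hS' i hi j hj hij; omega)), zero_vadd]
  · intro i hi d w hw
    obtain ⟨x, hx, x', hx', h0, h1, h2⟩ := hpt w hw i d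
    rw [h1 _ (hcS i hi), h2 _ (hcS i hi)]
    exact (hbound x hx x' hx' a i (haS i hi) h0).1 _ (by omega)
  · intro i hi d w hw
    obtain ⟨x, hx, x', hx', h0, h1, h2⟩ := hpt w hw i d
    rw [h1 _ (hcS i hi), h2 _ (hcS i hi), h1 _ le_rfl, h2 _ le_rfl, add_sub_cancel]
    exact (hbound x hx x' hx' a i (haS i hi) h0).2 l c hl1 (hcS i hi)
  · have h0 : 0 ≤ 1 - 1 / C := by
      rw [sub_nonneg, div_le_one hC0]; exact hC
    have h1 : (1 - 1 / C) ^ S'.card ≤ (1 - 1 / C) ^ n :=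
      pow_le_pow_of_le_one h0 (by have := one_div_pos.2 hC0; linarith) hS'n
    linarith

end HarmonicMixing

section Cesaro

/-- The averages of `u` converge. -/
def CesaroConverges {𝕜 : Type*} [RCLike 𝕜] (u : ℕ → 𝕜) : Prop :=
  ∃ L, Tendsto (fun n : ℕ => (n : 𝕜)⁻¹ * ∑ i ∈ Finset.range n, u i) atTop (𝓝 L)

lemma CesaroConverges.add {𝕜 : Type*} [RCLike 𝕜] {u v : ℕ → 𝕜} (hu : CesaroConverges u)
    (hv : CesaroConverges v) : CesaroConverges fun n => u n + v n := by
  obtain ⟨L, hL⟩ := hu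
  obtain ⟨L', hL'⟩ := hv
  exact ⟨L + L', by simpa only [Finset.sum_add_distrib, mul_add] using hL.add hL'⟩

lemma CesaroConverges.const_mul {𝕜 : Type*} [RCLike 𝕜] {u : ℕ → 𝕜} (hu : CesaroConverges u)
    (a : 𝕜) : CesaroConverges fun n => a * u n := by
  obtain ⟨L, hL⟩ := hu
  exact ⟨a * L, by simpa only [← Finset.mul_sum, mul_left_comm] using hL.const_mul a⟩

lemma CesaroConverges.of_eventually_periodic {𝕜 : Type*} [RCLike 𝕜] {u : ℕ → 𝕜} {m p : ℕ}
    (hp : 0 < p) (h : ∀ n, m ≤ n → u (n + p) = u n) : CesaroConverges u := by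
  set L : 𝕜 := (p : 𝕜)⁻¹ * ∑ i ∈ Finset.range p, u (m + i) with hL
  have hp0 : (p : 𝕜) ≠ 0 := Nat.cast_ne_zero.2 hp.ne'
  set S : ℕ → 𝕜 := fun n => ∑ i ∈ Finset.range n, (u i - L) with hS
  have hper : ∀ n, S (m + n + p) = S (m + n) := by
    intro n
    induction n with
    | zero =>
      simp only [hS, add_zero, Finset.sum_range_add, Finset.sum_sub_distrib, Finset.sum_const,
        Finset.card_range, nsmul_eq_mul, hL]
      push_cast
      field_simp
      ring
    | succ n ih =>
      simp only [hS] at ih ⊢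
      rw [show m + (n + 1) + p = (m + n + p) + 1 by ring, ← add_assoc m n 1,
        Finset.sum_range_succ, ih, Finset.sum_range_succ _ (m + n), h _ (by omega)]
  have hbd : ∀ n, ‖S n‖ ≤ ∑ i ∈ Finset.range (m + p), ‖S i‖ := by
    intro n
    induction n using Nat.strong_induction_on with
    | _ n ih =>
      by_cases hn : n < m + p
      · exact Finset.single_le_sum (f := fun i => ‖S i‖) (fun i _ => norm_nonneg _)
          (Finset.mem_range.2 hn)
      · obtain ⟨k, rfl⟩ := Nat.exists_eq_add_of_le (not_lt.1 hn)
        rw [show m + p + k = m + k + p by ring, hper]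
        exact ih _ (by omega)
  refine ⟨L, ?_⟩
  have h0 : Tendsto (fun n : ℕ => (n : 𝕜)⁻¹ * S n) atTop (𝓝 0) := by
    rw [tendsto_zero_iff_norm_tendsto_zero]
    refine squeeze_zero (fun n => norm_nonneg _) (g := fun n : ℕ =>
      (n : ℝ)⁻¹ * ∑ i ∈ Finset.range (m + p), ‖S i‖) (fun n => ?_) ?_
    · rw [norm_mul, norm_inv, RCLike.norm_natCast]
      gcongr
      exact hbd n
    · simpa using tendsto_inv_atTop_nhds_zero_nat.mul_const (∑ i ∈ Finset.range (m + p), ‖S i‖)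
  have h1 := h0.add_const L
  rw [zero_add] at h1
  refine h1.congr' ((eventually_gt_atTop 0).mono fun n hn => ?_)
  have hn0 : (n : 𝕜) ≠ 0 := Nat.cast_ne_zero.2 hn.ne'
  simp only [hS, Finset.sum_sub_distrib, Finset.sum_const, Finset.card_range, nsmul_eq_mul]
  field_simp
  ring

lemma CesaroConverges.of_norm_le {𝕜 : Type*} [RCLike 𝕜] {u : ℕ → 𝕜} {w : ℕ → ℝ}
    (hw : Tendsto (fun n : ℕ => (n : ℝ)⁻¹ * ∑ i ∈ Finset.range n, w i) atTop (𝓝 0))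
    (h : ∀ ε > 0, ∃ R : ℝ, ∀ n, ‖u n‖ ≤ ε + R * w n) : CesaroConverges u := by
  refine ⟨0, Metric.tendsto_atTop'.2 fun ε hε => ?_⟩
  obtain ⟨R, hR⟩ := h (ε / 2) (half_pos hε)
  have h1 := hw.const_mul R
  rw [mul_zero] at h1
  obtain ⟨n₀, hn₀⟩ := eventually_atTop.1 (h1.eventually (gt_mem_nhds (half_pos hε)))
  refine ⟨n₀, fun n hn => ?_⟩
  have hn1 : (0 : ℝ) < n := Nat.cast_pos.2 (by omega)
  rw [dist_zero_right, norm_mul, norm_inv, RCLike.norm_natCast]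
  calc (n : ℝ)⁻¹ * ‖∑ i ∈ Finset.range n, u i‖
      ≤ (n : ℝ)⁻¹ * ∑ i ∈ Finset.range n, (ε / 2 + R * w i) := by
        gcongr
        exact (norm_sum_le _ _).trans (Finset.sum_le_sum fun i _ => hR i)
    _ = ε / 2 + R * ((n : ℝ)⁻¹ * ∑ i ∈ Finset.range n, w i) := by
        rw [Finset.sum_add_distrib, ← Finset.mul_sum, Finset.sum_const, Finset.card_range,
          nsmul_eq_mul]
        field_simp
    _ < ε / 2 + ε / 2 := by gcongr; exact hn₀ n hn.le
    _ = ε := add_halves ε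

/-- The iterates of a map which descends to a finite quotient are eventually periodic there. -/
lemma exists_iterate_periodic {X Q : Type*} [Finite Q] {U : X → X} {c : X → Q}
    (hU : ∀ x y, c x = c y → c (U x) = c (U y)) :
    ∃ m p : ℕ, 0 < p ∧ ∀ n, m ≤ n → ∀ x, c (U^[n + p] x) = c (U^[n] x) := by
  have hiter : ∀ n x y, c x = c y → c (U^[n] x) = c (U^[n] y) := by
    intro n
    induction n with
    | zero => exact fun x y h => h
    | succ n ih => exact fun x y h => by simpa using ih _ _ (hU x y h)
  let T : ℕ → Set.range c → Q := fun n a => c (U^[n] a.2.choose)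
  have hT : ∀ n x, T n ⟨c x, x, rfl⟩ = c (U^[n] x) := fun n x =>
    hiter n _ _ (Exists.choose_spec (p := fun y => c y = c x) ⟨x, rfl⟩)
  obtain ⟨m, -, k, -, hmk, hTmk⟩ := Set.infinite_univ.exists_lt_map_eq_of_mapsTo
    (f := T) (t := Set.univ) (fun _ _ => trivial) Set.finite_univ
  refine ⟨m, k - m, by omega, fun n hn x => ?_⟩
  obtain ⟨l, rfl⟩ := Nat.exists_eq_add_of_le hn
  rw [show m + l + (k - m) = l + k by omega, add_comm m l, Function.iterate_add_apply,
    Function.iterate_add_apply]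
  refine hiter l _ _ ?_
  rw [← hT, ← hT, hTmk]

end Cesaro

section Riesz

open CompactlySupported in
/-- Riesz representation of a normalized positive linear functional on `C(X, ℝ)`. -/
lemma exists_probability_measure_of_positive {X : Type*} [TopologicalSpace X] [CompactSpace X]
    [T2Space X] [MeasurableSpace X] [BorelSpace X] (L : C(X, ℝ) →ₗ[ℝ] ℝ)
    (hL : ∀ f, 0 ≤ f → 0 ≤ L f) (h1 : L 1 = 1) :
    ∃ κ : Measure X, IsProbabilityMeasure κ ∧ ∀ f : C(X, ℝ), ∫ x, f x ∂κ = L f := by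
  let Λ : C_c(X, ℝ) →ₚ[ℝ] ℝ := PositiveLinearMap.mk₀
    { toFun := fun f => L f
      map_add' := fun f g => L.map_add f g
      map_smul' := fun a f => L.map_smul a f } fun f hf => hL f hf
  have key : ∀ f : C(X, ℝ), ∫ x, f x ∂(RealRMK.rieszMeasure Λ) = L f := fun f =>
    RealRMK.integral_rieszMeasure Λ (CompactlySupportedContinuousMap.continuousMapEquiv f)
  refine ⟨RealRMK.rieszMeasure Λ, ⟨?_⟩, key⟩
  have := key 1
  simp only [ContinuousMap.one_apply, integral_const, smul_eq_mul, mul_one, h1] at this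
  rwa [measureReal_def, ENNReal.toReal_eq_one_iff] at this

/-- Cesàro means converge weakly as soon as they converge on a uniformly dense set of functions. -/
lemma exists_cesaro_limit_of_dense {X : Type*} [TopologicalSpace X] [CompactSpace X]
    [T2Space X] [MeasurableSpace X] [BorelSpace X] {μ : Measure X} [IsProbabilityMeasure μ]
    {Φ : X → X} (hΦ : Continuous Φ)
    (h : ∀ f : C(X, ℝ), ∀ ε > 0, ∃ f' : C(X, ℝ), (∀ x, |f x - f' x| ≤ ε) ∧
      CesaroConverges fun n => ∫ x, f' (Φ^[n] x) ∂μ) :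
    ∃ κ : Measure X, IsProbabilityMeasure κ ∧ ∀ f : C(X, ℝ), Tendsto
      (fun N : ℕ => (N : ℝ)⁻¹ * ∑ n ∈ Finset.range N, ∫ x, f (Φ^[n] x) ∂μ)
      atTop (𝓝 (∫ x, f x ∂κ)) := by
  have hintegral : ∀ (f : C(X, ℝ)) n, Integrable (fun x => f (Φ^[n] x)) μ := fun f n =>
    (f.continuous.comp (hΦ.iterate n)).integrable_of_hasCompactSupport
      (HasCompactSupport.of_compactSpace _)
  have hconv : ∀ f : C(X, ℝ), CesaroConverges fun n => ∫ x, f (Φ^[n] x) ∂μ := by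
    intro f
    refine cauchySeq_tendsto_of_complete (Metric.cauchySeq_iff'.2 fun ε hε => ?_)
    obtain ⟨f', hf', L, hL⟩ := h f (ε / 4) (by positivity)
    obtain ⟨N, hN⟩ := Metric.tendsto_atTop.1 hL (ε / 4) (by positivity)
    have hdist : ∀ n : ℕ, dist ((n : ℝ)⁻¹ * ∑ i ∈ Finset.range n, ∫ x, f (Φ^[i] x) ∂μ)
        ((n : ℝ)⁻¹ * ∑ i ∈ Finset.range n, ∫ x, f' (Φ^[i] x) ∂μ) ≤ ε / 4 := by
      intro n
      rcases n.eq_zero_or_pos with rfl | hn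
      · simpa using by positivity
      have hn0 : (0 : ℝ) < n := Nat.cast_pos.2 hn
      rw [Real.dist_eq, ← mul_sub, ← Finset.sum_sub_distrib, abs_mul, abs_of_nonneg (by positivity),
        inv_mul_le_iff₀ hn0]
      refine (Finset.abs_sum_le_sum_abs _ _).trans ?_
      refine (Finset.sum_le_card_nsmul _ _ (ε / 4) fun i _ => ?_).trans (by simp)
      rw [← integral_sub (hintegral f i) (hintegral f' i)]
      have := norm_integral_le_of_norm_le_const (μ := μ) (C := ε / 4)
        (f := fun x => f (Φ^[i] x) - f' (Φ^[i] x)) (Eventually.of_forall fun x => hf' _)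
      simpa using this
    refine ⟨N, fun n hn => ?_⟩
    have h1 := hdist n
    have h2 := hdist N
    have h3 := hN n hn
    have h4 := hN N le_rfl
    rw [dist_comm] at h2 h4
    have := dist_triangle4 ((n : ℝ)⁻¹ * ∑ i ∈ Finset.range n, ∫ x, f (Φ^[i] x) ∂μ)
      ((n : ℝ)⁻¹ * ∑ i ∈ Finset.range n, ∫ x, f' (Φ^[i] x) ∂μ)
      ((N : ℝ)⁻¹ * ∑ i ∈ Finset.range N, ∫ x, f' (Φ^[i] x) ∂μ)
      ((N : ℝ)⁻¹ * ∑ i ∈ Finset.range N, ∫ x, f (Φ^[i] x) ∂μ)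
    have h5 := dist_triangle ((n : ℝ)⁻¹ * ∑ i ∈ Finset.range n, ∫ x, f' (Φ^[i] x) ∂μ) L
      ((N : ℝ)⁻¹ * ∑ i ∈ Finset.range N, ∫ x, f' (Φ^[i] x) ∂μ)
    linarith
  choose L hL using hconv
  let L' : C(X, ℝ) →ₗ[ℝ] ℝ :=
    { toFun := L
      map_add' := fun f g => tendsto_nhds_unique (hL (f + g)) (by
        refine ((hL f).add (hL g)).congr fun N => ?_
        rw [← mul_add, ← Finset.sum_add_distrib]
        simp only [ContinuousMap.add_apply, integral_add (hintegral f _) (hintegral g _)])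
      map_smul' := fun a f => tendsto_nhds_unique (hL (a • f)) (by
        refine ((hL f).const_mul a).congr fun N => ?_
        simp only [ContinuousMap.smul_apply, smul_eq_mul, integral_const_mul, ← Finset.mul_sum,
          mul_left_comm]) }
  obtain ⟨κ, hκ, hκL⟩ := exists_probability_measure_of_positive L'
    (fun f hf => ge_of_tendsto' (hL f) fun N => mul_nonneg (by positivity)
      (Finset.sum_nonneg fun n _ => integral_nonneg fun x => hf _))
    (tendsto_nhds_unique (hL 1) (tendsto_const_nhds.congr'
      ((eventually_gt_atTop 0).mono fun N hN => by
        have : (N : ℝ) ≠ 0 := Nat.cast_ne_zero.2 hN.ne'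
        simp [this])))
  exact ⟨κ, hκ, fun f => by rw [hκL]; exact hL f⟩

end Riesz

section LocalFunctions

variable {G : Type*}

lemma continuous_of_dependsOn [TopologicalSpace G] [DiscreteTopology G] {A : Type*}
    [TopologicalSpace A] {F : (ℤ → G) → A} {J : Set ℤ} (hJ : J.Finite) (hF : DependsOn F J) :
    Continuous F := by
  refine continuous_iff_continuousAt.2 fun x => ?_
  have hopen : IsOpen (J.pi fun t => ({x t} : Set G)) :=
    isOpen_set_pi hJ fun t _ => isOpen_discrete _
  refine continuousAt_const.congr (f := fun _ => F x)
    (Filter.mem_of_superset (hopen.mem_nhds fun t _ => rfl) fun y hy => ?_)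
  exact hF fun t ht => (hy t ht).symm

lemma exists_local_approx [Finite G] [TopologicalSpace G] [DiscreteTopology G] (f : C(ℤ → G, ℝ))
    {ε : ℝ} (hε : 0 < ε) :
    ∃ (q : ℕ) (f' : C(ℤ → G, ℝ)), DependsOn f' (Set.Ico (-q : ℤ) q) ∧ ∀ x, |f x - f' x| ≤ ε := by
  classical
  rcases isEmpty_or_nonempty (ℤ → G) with hX | ⟨⟨x₀⟩⟩
  · exact ⟨0, f, fun x => (hX.false x).elim, fun x => (hX.false x).elim⟩
  have hloc : ∀ x, ∃ J : Finset ℤ, ∀ y, (∀ t ∈ J, y t = x t) → |f y - f x| < ε / 2 := by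
    intro x
    obtain ⟨J, u, hu, hJ⟩ := isOpen_pi_iff.1
      ((Metric.isOpen_ball (x := f x) (ε := ε / 2)).preimage f.continuous) x
      (Metric.mem_ball_self (half_pos hε))
    exact ⟨J, fun y hy => hJ fun t ht => by rw [hy t ht]; exact (hu t ht).2⟩
  choose J hJ using hloc
  obtain ⟨T, hT⟩ := CompactSpace.elim_nhds_subcover
    (fun x => (J x : Set ℤ).pi fun t => ({x t} : Set G))
    (fun x => (isOpen_set_pi (J x).finite_toSet fun t _ => isOpen_discrete _).mem_nhds
      fun t _ => rfl)
  obtain ⟨q, hq⟩ : ∃ q : ℕ, ∀ x ∈ T, ∀ t ∈ J x, -(q : ℤ) ≤ t ∧ t < q := by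
    refine ⟨(T.biUnion J).sup Int.natAbs + 1, fun x hx t ht => ?_⟩
    have := Finset.le_sup (f := Int.natAbs) (Finset.mem_biUnion.2 ⟨x, hx, ht⟩)
    omega
  let τ : (ℤ → G) → ℤ → G := fun x t => if t ∈ Set.Ico (-q : ℤ) q then x t else x₀ t
  have hτ : DependsOn (fun x => f (τ x)) (Set.Ico (-q : ℤ) q) := by
    intro x y hxy
    have : τ x = τ y := by
      ext t
      simp only [τ]
      split_ifs with h
      · exact hxy t h
      · rfl
    simp only [this]
  refine ⟨q, ⟨fun x => f (τ x), continuous_of_dependsOn (Set.finite_Ico _ _) hτ⟩, hτ, fun y => ?_⟩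
  obtain ⟨x, hx, hy⟩ : ∃ x ∈ T, ∀ t ∈ J x, y t = x t := by
    have : y ∈ ⋃ x ∈ T, (J x : Set ℤ).pi fun t => ({x t} : Set G) := hT ▸ Set.mem_univ y
    simpa using this
  have h1 := hJ x y hy
  have h2 := hJ x (τ y) fun t ht => by
    simp only [τ]
    rw [if_pos (Set.mem_Ico.2 (hq x hx t ht)), hy t ht]
  simp only [ContinuousMap.coe_mk]
  rw [abs_lt] at h1 h2
  rw [abs_le]
  constructor <;> linarith

variable [Finite G] [TopologicalSpace G] [DiscreteTopology G] [MeasurableSpace (ℤ → G)]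
  [BorelSpace (ℤ → G)] {μ : Measure (ℤ → G)} [IsProbabilityMeasure μ] {Φ : (ℤ → G) → ℤ → G}

open Classical in
/-- To show convergence of the Cesàro means of local functions, it is enough to consider products of
cylinder functions in one coordinate and characters in the other one. -/
lemma cesaroConverges_of_products {K B : Type*} [AddCommGroup K] [Finite K] [Finite B]
    (hΦ : Continuous Φ) (θ : G ≃ K × B)
    (h : ∀ (q : ℕ) (h : (ℤ → B) → ℂ) (ψ : AddChar (ℤ → K) ℂ), DependsOn h (Set.Ico (-q : ℤ) q) →
      (∀ y, ‖h y‖ ≤ 1) → DependsOn ψ (Set.Ico (-q : ℤ) q) →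
      CesaroConverges fun n => ∫ x, h (fun t => (θ (Φ^[n] x t)).2) *
        ψ (fun t => (θ (Φ^[n] x t)).1) ∂μ)
    {F : (ℤ → G) → ℂ} {q : ℕ} (hF : DependsOn F (Set.Ico (-q : ℤ) q)) :
    CesaroConverges fun n => ∫ x, F (Φ^[n] x) ∂μ := by
  have hne : Nonempty (ℤ → G) := by
    have : NeZero μ := ⟨IsProbabilityMeasure.ne_zero μ⟩
    exact μ.nonempty_of_neZero
  obtain ⟨x₀⟩ := hne
  have := Fintype.ofFinite B
  have := Fintype.ofFinite K
  let I := Set.Ico (-q : ℤ) q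
  have hintegral : ∀ {F : (ℤ → G) → ℂ}, Continuous F → ∀ n, Integrable (fun x => F (Φ^[n] x)) μ :=
    fun hF n => (hF.comp (hΦ.iterate n)).integrable_of_hasCompactSupport
      (HasCompactSupport.of_compactSpace _)
  let P : Submodule ℂ ((ℤ → G) → ℂ) :=
    { carrier := {F | Continuous F ∧ CesaroConverges fun n => ∫ x, F (Φ^[n] x) ∂μ}
      add_mem' := fun h h' => ⟨h.1.add h'.1, by
        simpa only [Pi.add_apply, integral_add (hintegral h.1 _) (hintegral h'.1 _)] using h.2.add h'.2⟩
      zero_mem' := ⟨continuous_const, by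
        simpa using CesaroConverges.of_eventually_periodic (𝕜 := ℂ) (u := fun _ => 0) (m := 0)
          one_pos fun _ _ => rfl⟩
      smul_mem' := fun a F h => ⟨h.1.const_smul a, by
        simpa only [Pi.smul_apply, smul_eq_mul, integral_const_mul] using h.2.const_mul a⟩ }
  let pr : (ℤ → K) →+ (I → K) := ⟨⟨fun x t => x t, rfl⟩, fun _ _ => rfl⟩
  let f : (I → B) → AddChar (I → K) ℂ → (ℤ → G) → ℂ := fun b χ x =>
    (if (fun t : I => (θ (x t)).2) = b then 1 else 0) * χ (fun t : I => (θ (x t)).1)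
  have hf : ∀ b χ, f b χ ∈ P := by
    intro b χ
    refine ⟨continuous_of_dependsOn (Set.finite_Ico (-q : ℤ) q) fun x y hxy => ?_, ?_⟩
    · have : ∀ t : I, x t = y t := fun t => hxy t t.2
      simp only [f, this]
    · refine h q (fun y => if (fun t : I => y t) = b then 1 else 0) (χ.compAddMonoidHom pr)
        (fun x y hxy => ?_) (fun y => ?_) (fun x y hxy => ?_)
      · have : ∀ t : I, x t = y t := fun t => hxy t t.2
        simp only [this]
      · split_ifs <;> simp
      · have : pr x = pr y := funext fun t => hxy t t.2
        simp only [AddChar.compAddMonoidHom_apply, this]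
  let F' : (I → B) → (I → K) → ℂ := fun b k =>
    F (extendWord (x₀ 0) fun t => θ.symm (k t, b t))
  have hFP : F = ∑ b, ∑ χ, (AddChar.complexBasis (I → K)).repr (F' b) χ • f b χ := by
    ext x
    have h1 : F x = F' (fun t => (θ (x t)).2) (fun t => (θ (x t)).1) := hF fun t ht => by
      rw [extendWord_apply _ _ ht, Prod.mk.eta, θ.symm_apply_apply]
    have h2 : ∀ b, (∑ χ, (AddChar.complexBasis (I → K)).repr (F' b) χ • f b χ) x =
        if (fun t : I => (θ (x t)).2) = b then F' b fun t => (θ (x t)).1 else 0 := by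
      intro b
      conv_rhs => rw [← (AddChar.complexBasis (I → K)).sum_repr (F' b)]
      split_ifs with hb <;> simp [f, Finset.sum_apply, hb]
    rw [h1, Finset.sum_apply, Finset.sum_congr rfl fun b _ => h2 b, Fintype.sum_eq_single _
      fun b hb => if_neg hb.symm, if_pos rfl]
  have hmem : F ∈ P := by
    rw [hFP]
    exact P.sum_mem fun b _ => P.sum_mem fun χ _ => P.smul_mem _ (hf b χ)
  exact hmem.2

end LocalFunctions

section Cosets

variable {G K B : Type*} [AddCommGroup K] {E : Set (G × G)} {φ : G → G → G}

lemma CA_translate (φ : G → G → G) (m : ℤ) (n : ℕ) (x : ℤ → G) :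
    (CA φ)^[n] (fun t => x (t + m)) = fun t => (CA φ)^[n] x (t + m) := by
  induction n generalizing x with
  | zero => rfl
  | succ n ih =>
    rw [Function.iterate_succ_apply, Function.iterate_succ_apply, ← ih]
    congr 1
    ext t
    simp only [CA]
    rw [add_right_comm]

lemma continuous_CA [TopologicalSpace G] [DiscreteTopology G] (φ : G → G → G) :
    Continuous (CA φ) :=
  continuous_pi fun t => (continuous_of_discreteTopology (f := fun p : G × G => φ p.1 p.2)).comp
    (g := fun p : G × G => φ p.1 p.2) (f := fun x : ℤ → G => (x t, x (t + 1)))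
    ((continuous_apply t).prodMk (continuous_apply (t + 1)))

/-- A local function which is invariant under the homoclinic group has eventually periodic, hence
Cesàro convergent, integrals along the orbit of the measure. -/
lemma cesaroConverges_of_trivial [Finite K] [Finite B] [TopologicalSpace G] [DiscreteTopology G]
    [MeasurableSpace G] [BorelSpace (ℤ → G)] {μ : Measure (ℤ → G)}
    (hμ : Measure.map shiftMap μ = μ) (hμE : ∀ᵐ x ∂μ, x ∈ TMC E) (θ : G ≃ K × B)
    {η ρ : K →+ K} {c : K} {s : B → B} {V : AddSubgroup (K × K)} (h1 : ∀ a, ∃ b, (a, b) ∈ V)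
    (h2 : ∀ b, ∃ a, (a, b) ∈ V) (hη : ∀ a b, (a, b) ∈ V → (η a, η b) ∈ V)
    (hρ : ∀ a b, (a, b) ∈ V → (ρ a, ρ b) ∈ V) (hE : ∀ x ∈ TMC E, CA φ x ∈ TMC E)
    (hφ : ∀ x ∈ TMC E, ∀ t, θ (CA φ x t) =
      (η (θ (x t)).1 + ρ (θ (x (t + 1))).1 + c, s (θ (x (t + 1))).2))
    (hsub : ∀ x ∈ TMC E, ∀ y ∈ TMC E,
      (fun t => (θ (x t)).1 - (θ (y t)).1) ∈ TMC (V : Set (K × K)))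
    {q : ℕ} {h : (ℤ → B) → ℂ} {ψ : AddChar (ℤ → K) ℂ} (hh : DependsOn h (Set.Ico (-q : ℤ) q))
    (hψ : DependsOn ψ (Set.Ico (-q : ℤ) q))
    (hψ1 : ∀ d ∈ TMC (V : Set (K × K)), (Function.support d).Finite → ψ d = 1) :
    CesaroConverges fun n => ∫ x, h (fun t => (θ ((CA φ)^[n] x t)).2) *
      ψ (fun t => (θ ((CA φ)^[n] x t)).1) ∂μ := by
  let f : (ℤ → G) → ℂ := fun x => h (fun t => (θ (x t)).2) * ψ (fun t => (θ (x t)).1)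
  have hf : Continuous f := continuous_of_dependsOn (Set.finite_Ico (-q : ℤ) q) fun x y hxy => by
    simp only [f]
    congr 1
    · exact hh fun t ht => by rw [hxy t ht]
    · exact hψ fun t ht => by rw [hxy t ht]
  let u : (ℤ → G) → ℤ → G := fun x t => CA φ x (t + -1)
  have huE : Set.MapsTo u (TMC E) (TMC E) := fun x hx => TMC_shift (hE x hx) _
  have hu : ∀ n x, u^[n] x = (CA φ)^[n] fun t => x (t + -n) := by
    intro n x
    rw [CA_translate]
    induction n with
    | zero => simp
    | succ n ih =>
      rw [Function.iterate_succ_apply', ih]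
      ext t
      simp only [u, CA, Function.iterate_succ_apply']
      rw [show t + -1 + -(n : ℤ) = t + -((n + 1 : ℕ) : ℤ) by push_cast; ring,
        show t + -1 + 1 + -(n : ℤ) = t + -((n + 1 : ℕ) : ℤ) + 1 by push_cast; ring]
  have hintegral : ∀ n : ℕ, ∫ x, f ((CA φ)^[n] x) ∂μ = ∫ x, f (u^[n] x) ∂μ := by
    intro n
    simp only [hu]
    have hp := measurePreserving_translate hμ (-n)
    rw [← integral_map (f := fun x => f ((CA φ)^[n] x)) hp.aemeasurable, hp.map_eq]
    exact (hf.comp ((continuous_CA φ).iterate n)).aestronglyMeasurable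
  let cl : TMC E → (K ⧸ reachable V) × (Set.Ico (-q : ℤ) q → B) := fun x =>
    ((θ (x.1 0)).1, fun t => (θ (x.1 t)).2)
  have hcl : ∀ x y : TMC E, cl x = cl y → f x = f y := by
    intro x y hxy
    obtain ⟨hK, hB⟩ := Prod.ext_iff.1 hxy
    have hd := hsub x x.2 y y.2
    obtain ⟨g, hg, hgfin, hgd⟩ := exists_homoclinic h1 h2 hd
      (by rw [← neg_mem_iff, neg_sub, sub_eq_neg_add]; exact QuotientAddGroup.eq.1 hK) q
    simp only [f]
    congr 1
    · exact hh fun t ht => congrFun hB ⟨t, ht⟩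
    · have e1 : (fun t => (θ (x.1 t)).1) =
          (fun t => (θ (x.1 t)).1 - (θ (y.1 t)).1) + fun t => (θ (y.1 t)).1 := by
        ext t; simp
      rw [e1, AddChar.map_add_eq_mul, ← hψ fun t ht => hgd t ht.1 ht.2.le, hψ1 g hg hgfin, one_mul]
  have hclu : ∀ x y : TMC E, cl x = cl y → cl (huE.restrict _ _ _ x) = cl (huE.restrict _ _ _ y) := by
    intro x y hxy
    obtain ⟨hK, hB⟩ := Prod.ext_iff.1 hxy
    have hd := hsub x x.2 y y.2
    have hθu : ∀ x : TMC E, ∀ t, θ (u x t) =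
        (η (θ (x.1 (t + -1))).1 + ρ (θ (x.1 t)).1 + c, s (θ (x.1 t)).2) := fun x t => by
      rw [hφ x x.2, neg_add_cancel_right]
    have h0 : (θ (x.1 0)).1 - (θ (y.1 0)).1 ∈ reachable V := by
      rw [← neg_mem_iff, neg_sub, sub_eq_neg_add]; exact QuotientAddGroup.eq.1 hK
    have hm1 := mem_reachable_of_mem_TMC h1 h2 hd h0 (-1)
    ext1
    · refine QuotientAddGroup.eq.2 ?_
      simp only [Set.MapsTo.val_restrict_apply, hθu, zero_add]
      rw [← sub_eq_neg_add, ← neg_mem_iff, neg_sub]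
      have := (reachable V).add_mem (map_mem_reachable hη hm1) (map_mem_reachable hρ h0)
      simp only [map_sub] at this
      convert this using 1
      abel
    · ext t
      simp only [cl, Set.MapsTo.val_restrict_apply, hθu]
      exact congrArg s (congrFun hB t)
  obtain ⟨m, p, hp, hper⟩ := exists_iterate_periodic hclu
  refine CesaroConverges.of_eventually_periodic hp (m := m) fun n hn => ?_
  change ∫ x, f ((CA φ)^[n + p] x) ∂μ = ∫ x, f ((CA φ)^[n] x) ∂μ
  rw [hintegral, hintegral]
  refine integral_congr_ae (hμE.mono fun x hx => ?_)
  have := hcl _ _ (hper n hn ⟨x, hx⟩)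
  simpa [Set.MapsTo.coe_iterate_restrict] using this

end Cosets

section Characters

variable {K : Type*} [AddCommGroup K]

/-- The linear cellular automaton with local rule `η a + ρ b`. -/
def linearCA (η ρ : K →+ K) : AddMonoid.End (ℤ → K) where
  toFun y t := η (y t) + ρ (y (t + 1))
  map_zero' := by ext; simp
  map_add' x y := by ext t; simp only [Pi.add_apply, map_add]; abel

lemma linearCA_apply (η ρ : K →+ K) (y : ℤ → K) (t : ℤ) :
    linearCA η ρ y t = η (y t) + ρ (y (t + 1)) := rfl

lemma linearCA_pow_eq_zero (η ρ : K →+ K) {a b : ℤ} (n : ℕ) {y : ℤ → K}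
    (hy : ∀ t, a ≤ t → t < b + n → y t = 0) {t : ℤ} (ha : a ≤ t) (hb : t < b) :
    (linearCA η ρ ^ n) y t = 0 := by
  induction n generalizing b t with
  | zero => exact hy t ha (by simpa using hb)
  | succ n ih =>
    have h : ∀ t, a ≤ t → t < b + 1 → (linearCA η ρ ^ n) y t = 0 := fun t h1 h2 =>
      ih (fun t h1 h2 => hy t h1 (by push_cast; omega)) h1 h2
    rw [pow_succ', End_mul_apply, linearCA_apply,
      h t ha (by omega), h (t + 1) (by omega) (by omega), map_zero, map_zero, add_zero]

/-- The points of the Markov group of `V` supported in `[0, m)`. -/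
def windowGroup (V : AddSubgroup (K × K)) (m : ℕ) : AddSubgroup (ℤ → K) where
  carrier := {d | d ∈ TMC (V : Set (K × K)) ∧ ∀ t, t < 0 ∨ (m : ℤ) ≤ t → d t = 0}
  zero_mem' := ⟨fun _ => V.zero_mem, fun _ _ => rfl⟩
  add_mem' := fun h h' => ⟨fun i => V.add_mem (h.1 i) (h'.1 i), fun t ht => by
    rw [Pi.add_apply, h.2 t ht, h'.2 t ht, add_zero]⟩
  neg_mem' := fun h => ⟨fun i => V.neg_mem (h.1 i), fun t ht => by
    rw [Pi.neg_apply, h.2 t ht, neg_zero]⟩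

instance (V : AddSubgroup (K × K)) (m : ℕ) [Finite K] : Finite (windowGroup V m) := by
  refine Finite.of_injective (β := Set.Ico (0 : ℤ) m → K) (fun d t => d.1 t) fun d d' h => ?_
  ext t
  by_cases ht : t ∈ Set.Ico (0 : ℤ) m
  · exact congrFun h ⟨t, ht⟩
  · rw [Set.mem_Ico, not_and_or, not_le, not_lt] at ht
    rw [d.2.2 t ht, d'.2.2 t ht]

/-- The endomorphism of the window group induced by an endomorphism of the letters. -/
def windowMap {V : AddSubgroup (K × K)} (m : ℕ) {e : K →+ K}
    (he : ∀ a b, (a, b) ∈ V → (e a, e b) ∈ V) : windowGroup V m →+ windowGroup V m where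
  toFun d := ⟨fun t => e (d.1 t), fun i => he _ _ (d.2.1 i), fun t ht => by
    simp only [d.2.2 t ht, map_zero]⟩
  map_zero' := by ext; simp
  map_add' d d' := by ext; simp

lemma windowMap_injective {V : AddSubgroup (K × K)} (m : ℕ) {e : K →+ K}
    (he : ∀ a b, (a, b) ∈ V → (e a, e b) ∈ V) (hinj : Function.Injective e) :
    Function.Injective (windowMap m he) := fun d d' h => by
  ext t
  exact hinj (congrFun (congrArg Subtype.val h) t)

/-- Precomposition of characters with an endomorphism. -/
def precompChar {D : Type*} [AddCommGroup D] (e : D →+ D) : AddMonoid.End (AddChar D ℂ) where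
  toFun χ := χ.compAddMonoidHom e
  map_zero' := by ext; simp
  map_add' χ χ' := by ext; simp

lemma precompChar_injective {D : Type*} [AddCommGroup D] {e : D →+ D}
    (he : Function.Surjective e) : Function.Injective (precompChar e) := fun χ χ' h => by
  ext d
  obtain ⟨d, rfl⟩ := he d
  exact DFunLike.congr_fun h d

/-- Translation of a window to start at `i`. -/
def windowTranslate (V : AddSubgroup (K × K)) (m : ℕ) (i : ℤ) : windowGroup V m →+ (ℤ → K) where
  toFun d t := d.1 (t - i)
  map_zero' := rfl
  map_add' _ _ := rfl

lemma linearCA_windowTranslate {V : AddSubgroup (K × K)} (m : ℕ) {η ρ : K →+ K}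
    (hη : ∀ a b, (a, b) ∈ V → (η a, η b) ∈ V) (hρ : ∀ a b, (a, b) ∈ V → (ρ a, ρ b) ∈ V) (i : ℤ)
    (d : windowGroup V m) :
    linearCA η ρ (windowTranslate V m i d) =
      windowTranslate V m i (windowMap m hη d) + windowTranslate V m (i - 1) (windowMap m hρ d) := by
  ext t
  change η (d.1 (t - i)) + ρ (d.1 (t + 1 - i)) = η (d.1 (t - i)) + ρ (d.1 (t - (i - 1)))
  rw [sub_sub_eq_add_sub, add_comm t 1]

/-- The character of the window group through which a translated window acts on the iterate of a
character. -/
def windowChar (V : AddSubgroup (K × K)) (m : ℕ) (η ρ : K →+ K) (ψ : AddChar (ℤ → K) ℂ) (n : ℕ)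
    (i : ℤ) : AddChar (windowGroup V m) ℂ :=
  ψ.compAddMonoidHom ((linearCA η ρ ^ n : AddMonoid.End (ℤ → K)).comp (windowTranslate V m i))

lemma windowChar_apply (V : AddSubgroup (K × K)) (m : ℕ) (η ρ : K →+ K) (ψ : AddChar (ℤ → K) ℂ)
    (n : ℕ) (i : ℤ) (d : windowGroup V m) :
    windowChar V m η ρ ψ n i d = ψ ((linearCA η ρ ^ n) (windowTranslate V m i d)) := rfl

lemma windowChar_succ {V : AddSubgroup (K × K)} (m : ℕ) {η ρ : K →+ K}
    (hη : ∀ a b, (a, b) ∈ V → (η a, η b) ∈ V) (hρ : ∀ a b, (a, b) ∈ V → (ρ a, ρ b) ∈ V)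
    (ψ : AddChar (ℤ → K) ℂ) (n : ℕ) (i : ℤ) :
    windowChar V m η ρ ψ (n + 1) i = precompChar (windowMap m hη) (windowChar V m η ρ ψ n i) +
      precompChar (windowMap m hρ) (windowChar V m η ρ ψ n (i - 1)) := by
  ext d
  rw [windowChar_apply, pow_succ, End_mul_apply, linearCA_windowTranslate m hη hρ, map_add,
    AddChar.map_add_eq_mul]
  rfl

lemma support_windowChar_finite (V : AddSubgroup (K × K)) (m : ℕ) (η ρ : K →+ K)
    {ψ : AddChar (ℤ → K) ℂ} {q : ℕ} (hψ : DependsOn ψ (Set.Ico (-q : ℤ) q)) (n : ℕ) :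
    (Function.support (windowChar V m η ρ ψ n)).Finite := by
  refine (Set.finite_Ico (-q - m : ℤ) (q + n)).subset fun i hi => ?_
  by_contra hni
  refine hi (DFunLike.ext _ _ fun d => ?_)
  rw [windowChar_apply, AddChar.zero_apply, ← AddChar.map_zero_eq_one ψ]
  refine hψ fun t ht => linearCA_pow_eq_zero η ρ (a := -q) (b := q) n (fun t h1 h2 => ?_) ht.1 ht.2
  refine d.2.2 _ ?_
  rw [Set.mem_Ico, not_and_or] at hni
  omega

lemma norm_addChar_pi_apply [Finite K] (ψ : AddChar (ℤ → K) ℂ) (y : ℤ → K) : ‖ψ y‖ = 1 := by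
  refine (isOfFinOrder_iff_pow_eq_one.2 ⟨Nat.card K, Nat.card_pos, ?_⟩).norm_eq_one
  rw [← AddChar.map_nsmul_eq_pow, ← AddChar.map_zero_eq_one ψ]
  congr 1
  ext t
  exact card_nsmul_eq_zero'

end Characters

section Nontrivial

variable {G K B : Type*} [AddCommGroup K] {E : Set (G × G)} {φ : G → G → G}

lemma exists_iterate_CA_formula (θ : G ≃ K × B) {η ρ : K →+ K} {c : K} {s : B → B}
    (hE : ∀ x ∈ TMC E, CA φ x ∈ TMC E)
    (hφ : ∀ x ∈ TMC E, ∀ t, θ (CA φ x t) =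
      (η (θ (x t)).1 + ρ (θ (x (t + 1))).1 + c, s (θ (x (t + 1))).2)) :
    ∃ k : ℕ → ℤ → K, ∀ n, ∀ x ∈ TMC E, ∀ t, θ ((CA φ)^[n] x t) =
      ((linearCA η ρ ^ n) (fun t => (θ (x t)).1) t + k n t, s^[n] (θ (x (t + n))).2) := by
  refine ⟨fun n => (fun y => linearCA η ρ y + fun _ => c)^[n] 0, fun n => ?_⟩
  induction n with
  | zero => intro x _ t; simp
  | succ n ih =>
    intro x hx t
    have hx' : (CA φ)^[n] x ∈ TMC E := Set.MapsTo.iterate hE n hx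
    rw [Function.iterate_succ_apply', hφ _ hx', ih x hx, ih x hx, pow_succ', End_mul_apply,
      Function.iterate_succ_apply']
    ext1
    · simp only [Function.iterate_succ_apply', Pi.add_apply, linearCA_apply, map_add]
      abel
    · simp only [Nat.cast_succ]
      rw [show t + 1 + (n : ℤ) = t + (n + 1) by ring]

/-- A character which is nontrivial on the homoclinic group has integrals converging to zero in
density along the orbit of the measure. -/
lemma cesaroConverges_of_nontrivial [Finite K] [Fintype G] [MeasurableSpace G]
    [MeasurableSingletonClass G] {μ : Measure (ℤ → G)} (hμ : GoodMeasure E μ) (hc : CCSD E μ)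
    (hμE : ∀ᵐ x ∂μ, x ∈ TMC E) (θ : G ≃ K × B) [AddAction K G]
    (hact : ∀ (d : K) (g : G), θ (d +ᵥ g) = (d + (θ g).1, (θ g).2))
    {η ρ : K →+ K} {c : K} {s : B → B} {V : AddSubgroup (K × K)}
    (hηi : Function.Injective η) (hρi : Function.Injective ρ) (hηρ : ∀ a, η (ρ a) = ρ (η a))
    (hη : ∀ a b, (a, b) ∈ V → (η a, η b) ∈ V)
    (hρ : ∀ a b, (a, b) ∈ V → (ρ a, ρ b) ∈ V) (hE : ∀ x ∈ TMC E, CA φ x ∈ TMC E)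
    (hφ : ∀ x ∈ TMC E, ∀ t, θ (CA φ x t) =
      (η (θ (x t)).1 + ρ (θ (x (t + 1))).1 + c, s (θ (x (t + 1))).2))
    (hVE : ∀ d ∈ TMC (V : Set (K × K)), ∀ x ∈ TMC E, (fun t => d t +ᵥ x t) ∈ TMC E)
    {q : ℕ} {h : (ℤ → B) → ℂ} {ψ : AddChar (ℤ → K) ℂ} (hh : DependsOn h (Set.Ico (-q : ℤ) q))
    (hh1 : ∀ y, ‖h y‖ ≤ 1) (hψ : DependsOn ψ (Set.Ico (-q : ℤ) q))
    {d₀ : ℤ → K} (hd₀ : d₀ ∈ TMC (V : Set (K × K))) (hd₀fin : (Function.support d₀).Finite)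
    (hψ1 : ψ d₀ ≠ 1) :
    CesaroConverges fun n => ∫ x, h (fun t => (θ ((CA φ)^[n] x t)).2) *
      ψ (fun t => (θ ((CA φ)^[n] x t)).1) ∂μ := by
  have := hμ.1
  obtain ⟨k, hk⟩ := exists_iterate_CA_formula θ hE hφ
  obtain ⟨i₀, m, d₁, hd₁⟩ : ∃ (i : ℤ) (m : ℕ) (d : windowGroup V m), windowTranslate V m i d = d₀ := by
    obtain ⟨a, ha⟩ := hd₀fin.bddBelow
    obtain ⟨b, hb⟩ := hd₀fin.bddAbove
    refine ⟨a, (b + 1 - a).toNat, ⟨fun t => d₀ (t + a), TMC_shift hd₀ a, fun t ht => ?_⟩, ?_⟩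
    · by_contra hne
      have h1 := ha hne
      have h2 := hb hne
      omega
    · ext t
      simp [windowTranslate]
  let a := windowChar V m η ρ ψ
  have ha0 : a 0 ≠ 0 := fun h0 => hψ1 <| by
    have := DFunLike.congr_fun (congrFun h0 i₀) d₁
    rwa [windowChar_apply, pow_zero, AddMonoid.End.coe_one, id, hd₁] at this
  have hsurj : ∀ {e : K →+ K} (he : ∀ a b, (a, b) ∈ V → (e a, e b) ∈ V), Function.Injective e →
      Function.Surjective (windowMap m he) := fun he hei =>
    Finite.injective_iff_surjective.1 (windowMap_injective m he hei)
  have hlim := tendsto_average_inv_ncard_support (e := precompChar (windowMap m hη))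
    (r := precompChar (windowMap m hρ)) (by
      ext χ d
      change χ _ = χ _
      congr 1
      ext t
      exact (hηρ _).symm) (precompChar_injective (hsurj hη hηi))
    (precompChar_injective (hsurj hρ hρi)) a (windowChar_succ m hη hρ ψ)
    (support_windowChar_finite V m η ρ hψ) ha0
  refine CesaroConverges.of_norm_le hlim fun ε hε => ?_
  obtain ⟨R, hR⟩ := exists_harmonic_mixing_bound hμ hc (windowGroup V m) (fun d hd => hd.2)
    (fun d hd i x hx => hVE _ (TMC_shift hd.1 (-i)) x hx) hε
  refine ⟨R + 1, fun n => ?_⟩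
  let F : (ℤ → G) → ℂ := fun x => h (fun t => s^[n] (θ (x (t + n))).2) *
    ψ ((linearCA η ρ ^ n) (fun t => (θ (x t)).1) + k n)
  have hF1 : ∀ x, ‖F x‖ ≤ 1 := fun x => by
    rw [norm_mul, norm_addChar_pi_apply, mul_one]
    exact hh1 _
  have hintegral : ∫ x, h (fun t => (θ ((CA φ)^[n] x t)).2) * ψ (fun t => (θ ((CA φ)^[n] x t)).1) ∂μ =
      ∫ x, F x ∂μ := integral_congr_ae <| hμE.mono fun x hx => by
    simp only [hk n x hx, F]
    rfl
  have hFloc : ∀ x y, (∀ t : ℤ, -(q + n : ℕ) ≤ t → t < (q + n : ℕ) → x t = y t) → F x = F y := by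
    intro x y hxy
    push_cast at hxy
    simp only [F]
    congr 1
    · exact hh fun t ht => by rw [hxy _ (by have := ht.1; omega) (by have := ht.2; omega)]
    · refine hψ fun t ht => ?_
      rw [Pi.add_apply, Pi.add_apply, ← sub_eq_zero, add_sub_add_right_eq_sub, ← Pi.sub_apply,
        ← map_sub]
      refine linearCA_pow_eq_zero η ρ (a := -q) (b := q) n (fun t h1 h2 => ?_) ht.1 ht.2
      rw [Pi.sub_apply, hxy t (by omega) h2, sub_self]
  have hsf := support_windowChar_finite V m η ρ hψ n
  rw [hintegral]
  have hw : (0 : ℝ) < ((Function.support (a n)).ncard + 1 : ℝ)⁻¹ := by positivity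
  by_cases hRn : R ≤ hsf.toFinset.card
  · refine (hR F (q + n) hFloc hF1 hsf.toFinset (a n) hRn (fun i hi => ?_) fun i _ d x => ?_).trans ?_
    · exact (Set.Finite.mem_toFinset _).1 hi
    · have e1 : (fun t => (d : ℤ → K) (t - i) + (θ (x t)).1) =
          windowTranslate V m i d + fun t => (θ (x t)).1 := rfl
      simp only [F, hact, e1, map_add, a, windowChar_apply]
      rw [add_assoc, AddChar.map_add_eq_mul ψ, mul_left_comm]
    · have : 0 ≤ ((R : ℝ) + 1) * ((Function.support (a n)).ncard + 1 : ℝ)⁻¹ := by positivity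
      linarith
  · have h1 : ‖∫ x, F x ∂μ‖ ≤ 1 := by
      simpa using norm_integral_le_of_norm_le_const (μ := μ) (Eventually.of_forall hF1)
    have h2 : 1 ≤ ((R : ℝ) + 1) * ((Function.support (a n)).ncard + 1 : ℝ)⁻¹ := by
      rw [← div_eq_mul_inv, one_le_div (by positivity), add_le_add_iff_right, Nat.cast_le,
        Set.ncard_eq_toFinset_card _ hsf]
      omega
    linarith

end Nontrivial

section Assembly

/-- The commutative group structure given by an abelian group operation. -/
noncomputable abbrev IsAbelianGroupOp.addCommGroup {K : Type*} {add : K → K → K}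
    (h : IsAbelianGroupOp add) : AddCommGroup K :=
  { add := add
    zero := h.2.2.choose
    neg := fun a => (h.2.2.choose_spec.2 a).choose
    add_assoc := h.1
    add_comm := h.2.1
    zero_add := h.2.2.choose_spec.1
    add_zero := fun a => (h.2.1 a _).trans (h.2.2.choose_spec.1 a)
    neg_add_cancel := fun a => (h.2.1 _ a).trans (h.2.2.choose_spec.2 a).choose_spec
    nsmul := @nsmulRec K ⟨h.2.2.choose⟩ ⟨add⟩
    zsmul := @zsmulRec K ⟨h.2.2.choose⟩ ⟨add⟩ ⟨fun a => (h.2.2.choose_spec.2 a).choose⟩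
      (@nsmulRec K ⟨h.2.2.choose⟩ ⟨add⟩) }

/-- The action of the group on the first factor of a product alphabet. -/
abbrev fstAddAction {G K B : Type*} [AddCommGroup K] (θ : G ≃ K × B) : AddAction K G where
  vadd d g := θ.symm (d + (θ g).1, (θ g).2)
  zero_vadd g := by
    change θ.symm (0 + (θ g).1, (θ g).2) = g
    rw [zero_add, Prod.mk.eta, θ.symm_apply_apply]
  add_vadd d d' g := by
    change θ.symm (d + d' + (θ g).1, (θ g).2) =
      θ.symm (d + (θ (θ.symm (d' + (θ g).1, (θ g).2))).1, (θ (θ.symm (d' + (θ g).1, (θ g).2))).2)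
    rw [θ.apply_symm_apply, add_assoc]

variable {G K B : Type*} [AddCommGroup K] {E : Set (G × G)} {φ : G → G → G}

open scoped Pointwise in
/-- Cesàro convergence for a cellular automaton which is, up to relabelling, the product of an
affine cellular automaton and a translation. -/
lemma exists_cesaro_limit_of_affine [Finite K] [Finite B] [Fintype G] [TopologicalSpace G]
    [DiscreteTopology G] [MeasurableSpace G] [MeasurableSingletonClass G] {μ : Measure (ℤ → G)}
    (hμ : GoodMeasure E μ) (hc : CCSD E μ) (θ : G ≃ K × B) {EK : Set (K × K)} {EB : Set (B × B)}
    (hEK : EveryLetterOccurs EK)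
    (hEθ : ∀ x, x ∈ TMC E ↔
      (fun t => (θ (x t)).1) ∈ TMC EK ∧ (fun t => (θ (x t)).2) ∈ TMC EB)
    {η ρ : K →+ K} {c : K} {s : B → B}
    (hη : Function.Injective η) (hρ : Function.Injective ρ) (hηρ : ∀ a, η (ρ a) = ρ (η a))
    (hE : ∀ x ∈ TMC E, CA φ x ∈ TMC E)
    (hφ : ∀ x ∈ TMC E, ∀ t, θ (CA φ x t) =
      (η (θ (x t)).1 + ρ (θ (x (t + 1))).1 + c, s (θ (x (t + 1))).2))
    (hEKc : ∀ p ∈ EK, ∀ q ∈ EK, (η p.1 + ρ q.1 + c, η p.2 + ρ q.2 + c) ∈ EK) :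
    ∃ κ : Measure (ℤ → G), IsProbabilityMeasure κ ∧ CesaroTendstoTo μ (CA φ) κ := by
  have := hμ.1
  have : BorelSpace G := inferInstance
  have hμE : ∀ᵐ x ∂μ, x ∈ TMC E :=
    mem_ae_iff.2 ((prob_compl_eq_zero_iff (measurableSet_TMC E)).2 hμ.2.2.1)
  let V : AddSubgroup (K × K) := AddAction.stabilizer (K × K) EK
  obtain ⟨hsubV, hηV, hρV⟩ := sub_mem_stabilizer_of_affine (S := EK) (e := η.prodMap η)
    (r := ρ.prodMap ρ) (hη.prodMap hη) (hρ.prodMap hρ) (c, c) hEKc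
  have hEKV : ∀ v ∈ V, ∀ p ∈ EK, v + p ∈ EK := fun v hv p hp => by
    have := Set.vadd_mem_vadd_set (a := v) hp
    rwa [AddAction.mem_stabilizer_iff.1 hv] at this
  have hsub : ∀ x ∈ TMC E, ∀ y ∈ TMC E,
      (fun t => (θ (x t)).1 - (θ (y t)).1) ∈ TMC (V : Set (K × K)) := fun x hx y hy i =>
    hsubV _ (((hEθ x).1 hx).1 i) _ (((hEθ y).1 hy).1 i)
  have h1 : ∀ a, ∃ b, (a, b) ∈ V := fun a => by
    obtain ⟨x, hx, i, hi⟩ := hEK 0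
    obtain ⟨y, hy, j, rfl⟩ := hEK a
    refine ⟨y (j + 1) - x (i + 1), ?_⟩
    have := hsubV _ (hy j) _ (hx i)
    rwa [hi, Prod.mk_sub_mk, sub_zero] at this
  have h2 : ∀ b, ∃ a, (a, b) ∈ V := fun b => by
    obtain ⟨x, hx, i, hi⟩ := hEK 0
    obtain ⟨y, hy, j, rfl⟩ := hEK b
    refine ⟨y (j - 1) - x (i - 1), ?_⟩
    have := hsubV _ (hy (j - 1)) _ (hx (i - 1))
    rwa [sub_add_cancel, sub_add_cancel, hi, Prod.mk_sub_mk, sub_zero] at this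
  let := fstAddAction θ
  have hact : ∀ (d : K) (g : G), θ (d +ᵥ g) = (d + (θ g).1, (θ g).2) := fun d g =>
    θ.apply_symm_apply _
  have hVE : ∀ d ∈ TMC (V : Set (K × K)), ∀ x ∈ TMC E, (fun t => d t +ᵥ x t) ∈ TMC E := by
    intro d hd x hx
    rw [hEθ] at hx ⊢
    simp only [hact]
    exact ⟨fun i => hEKV _ (hd i) _ (hx.1 i), hx.2⟩
  have hlocal : ∀ {F : (ℤ → G) → ℂ} {q : ℕ}, DependsOn F (Set.Ico (-q : ℤ) q) →
      CesaroConverges fun n => ∫ x, F ((CA φ)^[n] x) ∂μ := fun hF => by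
    refine cesaroConverges_of_products (continuous_CA φ) θ (fun q h ψ hh hh1 hψ => ?_) hF
    by_cases hψ1 : ∀ d ∈ TMC (V : Set (K × K)), (Function.support d).Finite → ψ d = 1
    · exact cesaroConverges_of_trivial hμ.2.1 hμE θ h1 h2 (fun a b => hηV (a, b))
        (fun a b => hρV (a, b)) hE hφ hsub hh hψ hψ1
    · push Not at hψ1
      obtain ⟨d₀, hd₀, hfin, hne⟩ := hψ1
      exact cesaroConverges_of_nontrivial hμ hc hμE θ hact hη hρ hηρ (fun a b => hηV (a, b))
        (fun a b => hρV (a, b)) hE hφ hVE hh hh1 hψ hd₀ hfin hne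
  refine exists_cesaro_limit_of_dense (continuous_CA φ) fun f ε hε => ?_
  obtain ⟨q, f', hf', hff'⟩ := exists_local_approx f hε
  refine ⟨f', hff', ?_⟩
  obtain ⟨L, hL⟩ := hlocal (F := fun x => (f' x : ℂ)) fun x y hxy =>
    congrArg ((↑) : ℝ → ℂ) (hf' hxy)
  refine ⟨L.re, ((Complex.continuous_re.tendsto L).comp hL).congr fun n => ?_⟩
  simp only [integral_complex_ofReal, Function.comp, ← Complex.ofReal_sum]
  rw [← Complex.ofReal_natCast, ← Complex.ofReal_inv, ← Complex.ofReal_mul, Complex.ofReal_re]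

end Assembly

end CAStmt

/-- Theorem (iii): Cesàro mean convergence for SC right-permutative c.a.
whose full-shift extension is `N`-scaling and whose associated affine c.a. is regular and
simple. -/
theorem CAStmt.stmt17 {G K B : Type} [Fintype G] [Fintype K] [Fintype B]
    [TopologicalSpace G] [DiscreteTopology G]
    [MeasurableSpace G] [MeasurableSingletonClass G]
    (E : Set (G × G)) (hE : EveryLetterOccurs E)
    (φ : G → G → G) (hSC : SC E φ) (hR : RightPerm φ)
    (N : ℕ) (hN : 2 ≤ N) (hscalFull : NScalingOn (Set.univ : Set (ℤ → G)) φ N)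
    (add φK : K → K → K) (haff : IsAffineRuleExpl add φK)
    (s : Equiv.Perm B)
    (EK : Set (K × K)) (EB : Set (B × B))
    (hEK : EveryLetterOccurs EK) (hEB : EveryLetterOccurs EB)
    (θ : G → K × B) (hθ : Function.Bijective θ)
    (hconj : OneBlockConjugacy (TMC E) (CA φ)
      (TMC (prodE EK EB)) (CA (fun p q : K × B => (φK p.1 q.1, s q.2))) θ)
    (hSCK : SC EK φK) (hbiK : RightPerm φK ∧ LeftPerm φK)
    (hRS : RegularSimple EK φK)
    (μ : Measure (ℤ → G)) (hgood : GoodMeasure E μ) (hccsd : CCSD E μ) :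
    ∃ κ : Measure (ℤ → G), IsProbabilityMeasure κ ∧ CesaroTendstoTo μ (CA φ) κ := by
  obtain ⟨hadd, η, ρ, c, hη, hρ, hηadd, hρadd, hηρ, hφK⟩ := haff
  let := hadd.addCommGroup
  let e := Equiv.ofBijective θ hθ
  refine exists_cesaro_limit_of_affine hgood hccsd e (EK := EK) (EB := EB) hEK (fun x => ?_)
    (η := AddMonoidHom.mk' η hηadd) (ρ := AddMonoidHom.mk' ρ hρadd) (c := c) (s := s)
    hη.injective hρ.injective hηρ (fun x hx => hSC x hx _ (TMC_shift hx 1)) (fun x hx t => ?_)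
    fun p hp q hq => ?_
  · have key : x ∈ TMC E ↔ θ ∘ x ∈ TMC (prodE EK EB) := by
      refine ⟨fun hx => hconj.1.mapsTo hx, fun hx => ?_⟩
      obtain ⟨y, hy, hyx⟩ := hconj.1.surjOn hx
      rwa [← hθ.injective.comp_left hyx]
    exact key.trans forall_and
  · exact (congrFun (hconj.2 x hx) t).trans (Prod.ext (hφK _ _) rfl)
  · have := hSCK.rule_mem hEK (a := p.1) (b := p.2) (a' := q.1) (b' := q.2) hp hq
    rwa [hφK, hφK] at this
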